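/- Suppose the pair of transitive models V ⊆ V' satisfies the δ-cover and δ-approximation properties and V and V' have the same ordinals. If λ ≥ δ is a regular cardinal in V', then the pair H_λ^V ⊆ H_λ^{V'} also satisfies the δ-cover and δ-approximation properties, and H_λ^V and H_λ^{V'} have the same ordinals. -/

import Mathlib

noncomputable section

namespace MPaper

open ZFSet

attribute [local instance] Classical.propDecidable

/-! ### Basic set-theoretic vocabulary over `ZFSet` -/

/-- The (external) cardinality of a ZFC set. -/
def zcard (x : ZFSet) : Cardinal := Cardinal.mk x.toSet

/-- `x` is a von Neumann ordinal: a transitive set of transitive sets. -/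
def IsOrd (x : ZFSet) : Prop := x.IsTransitive ∧ ∀ y ∈ x, ZFSet.IsTransitive y

/-- `κ` is a cardinal: an ordinal not equinumerous with any of its members. -/
def IsCard (κ : ZFSet) : Prop := IsOrd κ ∧ ∀ α ∈ κ, zcard α < zcard κ

/-- The ordinal `κ⁺`, the cardinal successor of `κ`. -/
def cardSuccOrd (κ : ZFSet) : Ordinal := (Order.succ (zcard κ)).ord

/-- `f` is a set-coded function with domain `d` (a set of Kuratowski pairs). -/
def IsZFunc (d f : ZFSet) : Prop :=
  (∀ p ∈ f, ∃ a ∈ d, ∃ b, p = ZFSet.pair a b) ∧ ∀ a ∈ d, ∃! b, ZFSet.pair a b ∈ f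

/-- Application of a set-coded function. -/
def fapp (f a : ZFSet) : ZFSet :=
  ⋃₀ (ZFSet.sep (fun b => ZFSet.pair a b ∈ f) (⋃₀ (⋃₀ f)))

/-- `f` maps `d` into `y`. -/
def MapsInto (f d y : ZFSet) : Prop := ∀ a ∈ d, fapp f a ∈ y

/-- `f` maps `d` onto `y`. -/
def SurjOnto (f d y : ZFSet) : Prop := MapsInto f d y ∧ ∀ b ∈ y, ∃ a ∈ d, fapp f a = b

/-- `f` is injective on `d`. -/
def InjOnZ (f d : ZFSet) : Prop := ∀ a ∈ d, ∀ b ∈ d, fapp f a = fapp f b → a = b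

/-- `f` is a bijection from `d` onto `y`. -/
def IsBij (f d y : ZFSet) : Prop := IsZFunc d f ∧ SurjOnto f d y ∧ InjOnZ f d

/-- The tail `κ ∖ α = {ξ ∈ κ | α ≤ ξ}` (for ordinals `α ∈ κ`). -/
def tailSet (κ α : ZFSet) : ZFSet := ZFSet.sep (fun ξ => ξ ∉ α) κ

/-- The relative complement `κ ∖ A`. -/
def compl (κ A : ZFSet) : ZFSet := ZFSet.sep (fun ξ => ξ ∉ A) κ

/-! ### First-order satisfaction in ∈-structures -/

/-- First order formulas in the language of set theory, with variables indexed by `ℕ`. -/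
inductive Fml : Type
  | mem : ℕ → ℕ → Fml
  | eq : ℕ → ℕ → Fml
  | impl : Fml → Fml → Fml
  | neg : Fml → Fml
  | all : ℕ → Fml → Fml

/-- Tarskian satisfaction of a formula in the ∈-structure with domain `D`. -/
def Sat (D : Set ZFSet) : Fml → (ℕ → ZFSet) → Prop
  | .mem i j, v => v i ∈ v j
  | .eq i j, v => v i = v j
  | .impl φ ψ, v => Sat D φ v → Sat D ψ v
  | .neg φ, v => ¬ Sat D φ v
  | .all n φ, v => ∀ x ∈ D, Sat D φ (Function.update v n x)

/-- `D` is an elementary substructure of `E` (as ∈-structures). -/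
def ElemSub (D E : Set ZFSet) : Prop :=
  D ⊆ E ∧ ∀ (φ : Fml) (v : ℕ → ZFSet), (∀ n, v n ∈ D) → (Sat D φ v ↔ Sat E φ v)

/-- `r` is a well-ordering of `x` (coded as a set of Kuratowski pairs). -/
def IsWellOrderOn (x r : ZFSet) : Prop :=
  (∀ p ∈ r, ∃ a ∈ x, ∃ b ∈ x, p = ZFSet.pair a b) ∧
  (∀ a ∈ x, ∀ b ∈ x, a = b ∨ ZFSet.pair a b ∈ r ∨ ZFSet.pair b a ∈ r) ∧
  (∀ a ∈ x, ∀ b ∈ x, ∀ c ∈ x,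
    ZFSet.pair a b ∈ r → ZFSet.pair b c ∈ r → ZFSet.pair a c ∈ r) ∧
  (∀ a ∈ x, ZFSet.pair a a ∉ r) ∧
  (∀ S : Set ZFSet, S ⊆ x.toSet → S.Nonempty → ∃ a ∈ S, ∀ b ∈ S, ZFSet.pair b a ∉ r)

/-- A transitive model of `ZFC⁻` (ZFC minus power set): a transitive set closed under
pairing and union, containing `ω`, satisfying the separation and collection schemes for
first-order formulas, and choice in the guise of the well-ordering principle.
(Extensionality and foundation hold automatically in transitive sets.) -/
def IsTransModel (M : ZFSet) : Prop :=
  M.IsTransitive ∧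
  ZFSet.omega ∈ M ∧
  (∀ x ∈ M, ∀ y ∈ M, ({x, y} : ZFSet) ∈ M) ∧
  (∀ x ∈ M, (⋃₀ x : ZFSet) ∈ M) ∧
  (∀ (φ : Fml) (v : ℕ → ZFSet), (∀ n, v n ∈ M) → ∀ a ∈ M,
    ∃ b ∈ M, ∀ x, x ∈ b ↔ x ∈ a ∧ Sat M.toSet φ (Function.update v 0 x)) ∧
  (∀ (φ : Fml) (v : ℕ → ZFSet), (∀ n, v n ∈ M) → ∀ a ∈ M,
    (∀ x ∈ a, ∃ y ∈ M, Sat M.toSet φ (Function.update (Function.update v 0 x) 1 y)) →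
    ∃ b ∈ M, ∀ x ∈ a, ∃ y ∈ b, Sat M.toSet φ (Function.update (Function.update v 0 x) 1 y)) ∧
  (∀ x ∈ M, ∃ r ∈ M, IsWellOrderOn x r)

/-! ### Weak κ-models, κ-models, M-ultrafilters -/

/-- A weak `κ`-model: a transitive model of ZFC⁻ of size `κ` with `κ ∈ M`. -/
def IsWeakModel (κ M : ZFSet) : Prop :=
  IsTransModel M ∧ κ ∈ M ∧ zcard M = zcard κ

/-- `M` is closed under `<κ`-sequences (of its elements). -/
def SeqClosed (κ M : ZFSet) : Prop :=
  ∀ γ ∈ κ, ∀ f : ZFSet, IsZFunc γ f → (∀ a ∈ γ, fapp f a ∈ M) → f ∈ M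

/-- A `κ`-model: a weak `κ`-model closed under `<κ`-sequences. -/
def IsKappaModel (κ M : ZFSet) : Prop := IsWeakModel κ M ∧ SeqClosed κ M

/-- `U` is an `M`-ultrafilter on `κ`: `⟨M, ∈, U⟩` thinks `U` is a normal ultrafilter on `κ`
containing all tail sets. -/
def IsMUltrafilter (κ M U : ZFSet) : Prop :=
  (∀ A ∈ U, A ∈ M ∧ A ⊆ κ) ∧
  (∀ α ∈ κ, tailSet κ α ∈ U) ∧
  (∅ : ZFSet) ∉ U ∧
  (∀ A ∈ U, ∀ B ∈ U, A ∩ B ∈ U) ∧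
  (∀ A ∈ U, ∀ B, B ∈ M → B ⊆ κ → A ⊆ B → B ∈ U) ∧
  (∀ B, B ∈ M → B ⊆ κ → B ∈ U ∨ compl κ B ∈ U) ∧
  (∀ f ∈ M, IsZFunc κ f → ZFSet.sep (fun ξ => fapp f ξ ∈ ξ) κ ∈ U →
    ∃ γ ∈ κ, ZFSet.sep (fun ξ => fapp f ξ = γ) κ ∈ U)

/-- `U` is weakly amenable for `M`: for every `X ∈ M` of size at most `κ` in `M`,
the intersection `X ∩ U` belongs to `M`. -/
def WeaklyAmenable (κ M U : ZFSet) : Prop :=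
  ∀ X ∈ M, (∃ f ∈ M.toSet, IsZFunc κ f ∧ ∀ y ∈ X, ∃ ξ ∈ κ, fapp f ξ = y) →
    X ∩ U ∈ M

/-- `U` is `ω₁`-intersecting: every countable collection of its members has a common element. -/
def OmegaOneIntersecting (U : ZFSet) : Prop :=
  ∀ s : ℕ → ZFSet, (∀ n, s n ∈ U) → ∃ x, ∀ n, x ∈ s n

/-- `M` contains (its version of) `V_κ`, i.e. the set of all sets of rank `< κ`. -/
def HasVkappa (κ M : ZFSet) : Prop :=
  ∃ v ∈ M.toSet, ∀ x, x ∈ v ↔ ZFSet.rank x < ZFSet.rank κ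

/-! ### Small universe measures and the associated models `M_U`, `N_U` -/

/-- `M` is the minimal model associated to `U` (the collection of Mostowski collapses of
well-founded relations on `κ` coded by sets in `U` and their complements): a weak `κ`-model
with `V_κ ∈ M` for which `U` is an `M`-ultrafilter, contained in every transitive
ZFC⁻-model `M'` with `κ ∈ M'` for which `U` is an `M'`-ultrafilter. -/
def IsMUModel (κ U M : ZFSet) : Prop :=
  IsWeakModel κ M ∧ HasVkappa κ M ∧ IsMUltrafilter κ M U ∧
  ∀ M', IsTransModel M' → κ ∈ M' → IsMUltrafilter κ M' U → M ⊆ M'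

/-- A small universe measure on `κ`: a set `U` of subsets of `κ` of size `κ` whose associated
minimal model `M_U` exists (is a weak `κ`-model with `V_κ ∈ M_U` and `U` an `M_U`-ultrafilter). -/
def IsSUMeasure (κ U : ZFSet) : Prop :=
  zcard U = zcard κ ∧ (∀ A ∈ U, A ⊆ κ) ∧ ∃ M, IsMUModel κ U M

/-- The minimal model `M_U` associated to a small universe measure `U`. -/
def MU (κ U : ZFSet) : ZFSet :=
  if h : ∃ M, IsMUModel κ U M then h.choose else ∅

/-- `j : M → N` is (up to isomorphism) the ultrapower embedding of `M` by the
`M`-ultrafilter `U` on `κ`, with `N` transitive (so the ultrapower is well-founded):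
`j` is elementary, every element of `N` has the form `j(f)(κ)` for `f : κ → M` in `M`,
and `U` is the `M`-ultrafilter derived from `j` with seed `κ`. -/
def IsUltrapowerEmb (κ M U N : ZFSet) (j : ZFSet → ZFSet) : Prop :=
  N.IsTransitive ∧
  (∀ x ∈ M, j x ∈ N) ∧
  (∀ (φ : Fml) (v : ℕ → ZFSet), (∀ n, v n ∈ M) →
    (Sat M.toSet φ v ↔ Sat N.toSet φ (fun n => j (v n)))) ∧
  (∀ a ∈ N, ∃ f ∈ M.toSet, IsZFunc κ f ∧ MapsInto f κ M ∧ fapp (j f) κ = a) ∧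
  (∀ A ∈ M, A ⊆ κ → (A ∈ U ↔ κ ∈ j A))

/-- The ultrapower of `M_U` by `U` is well-founded. -/
def UltrapowerWF (κ U : ZFSet) : Prop :=
  ∃ (N : ZFSet) (j : ZFSet → ZFSet), IsUltrapowerEmb κ (MU κ U) U N j

/-- A choice of transitive collapse of the ultrapower of `M_U` by `U`, with its embedding. -/
def upData (κ U : ZFSet) : ZFSet × (ZFSet → ZFSet) :=
  if h : ∃ p : ZFSet × (ZFSet → ZFSet), IsUltrapowerEmb κ (MU κ U) U p.1 p.2
  then h.choose else (∅, id)

/-- `N_U`: the transitive collapse of the ultrapower of `M_U` by `U` (when well-founded). -/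
def NU (κ U : ZFSet) : ZFSet := (upData κ U).1

/-- The ultrapower embedding `j_U : M_U → N_U`. -/
def jU (κ U : ZFSet) : ZFSet → ZFSet := (upData κ U).2

/-- `M_U⋆ = V_{j(κ)}^{N_U}`, the rank-initial segment of `N_U` below `j_U(κ)`. -/
def MUstar (κ U : ZFSet) : ZFSet :=
  ZFSet.sep (fun x => ZFSet.rank x < ZFSet.rank (jU κ U κ)) (NU κ U)

/-! ### Hereditary size, `H_{κ⁺}`, elementarity -/

/-- `x` has hereditary size at most `κ`. -/
def HeredLE (κ : ZFSet) : ZFSet → Prop :=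
  WellFounded.fix ZFSet.mem_wf
    (fun x ih => zcard x ≤ zcard κ ∧ ∀ y, ∀ h : y ∈ x, ih y h)

/-- The class `H_{κ⁺}` of sets of hereditary size at most `κ`. -/
def Hclass (κ : ZFSet) : Set ZFSet := { x | HeredLE κ x }

/-! ### The measures witnessing Ramsey and Ramsey-like cardinals -/

/-- A Ramsey measure on `κ`: a weakly amenable `ω₁`-intersecting small universe measure. -/
def IsRamseyMeasure (κ U : ZFSet) : Prop :=
  IsSUMeasure κ U ∧ WeaklyAmenable κ (MU κ U) U ∧ OmegaOneIntersecting U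

/-- A strong Ramsey measure on `κ`: a weakly amenable small universe measure whose
minimal model `M_U` is a `κ`-model. -/
def IsStrongRamseyMeasure (κ U : ZFSet) : Prop :=
  IsSUMeasure κ U ∧ WeaklyAmenable κ (MU κ U) U ∧ SeqClosed κ (MU κ U)

/-- A super Ramsey measure on `κ`: a strong Ramsey measure with `M_U ≺ H_{κ⁺}`. -/
def IsSuperRamseyMeasure (κ U : ZFSet) : Prop :=
  IsStrongRamseyMeasure κ U ∧ ElemSub (MU κ U).toSet (Hclass κ)

/-- `I` certifies `U`: `I` is an unbounded subset of `κ` and the sets in `U` are exactly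
the subsets of `κ` in `M_U` containing a tail of `I`. -/
def Certifies (κ U : ZFSet) (I : Set ZFSet) : Prop :=
  (∀ ξ ∈ I, ξ ∈ κ) ∧ (∀ α ∈ κ, ∃ ξ ∈ I, ξ ∉ α) ∧
  ∀ X ∈ (MU κ U).toSet, X ⊆ κ →
    (X ∈ U ↔ ∃ α ∈ κ.toSet, ∀ ξ ∈ I, ξ ∉ α → ξ ∈ X)

/-- A certified Ramsey measure on `κ`: a weakly amenable small universe measure which is
certified by some unbounded `I ⊆ κ`. -/
def IsCertifiedRamseyMeasure (κ U : ZFSet) : Prop :=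
  IsSUMeasure κ U ∧ WeaklyAmenable κ (MU κ U) U ∧ ∃ I : Set ZFSet, Certifies κ U I

/-! ### Relativized (internal) versions of the measure predicates -/

/-- `ω₁`-intersecting from the point of view of the transitive model `N`: every
`ω`-sequence of members of `U` lying in `N` has a common element. -/
def OmegaOneIntersectingIn (N U : ZFSet) : Prop :=
  ∀ f ∈ N.toSet, IsZFunc ZFSet.omega f → (∀ n ∈ ZFSet.omega, fapp f n ∈ U) →
    ∃ x, ∀ n ∈ ZFSet.omega, x ∈ fapp f n

/-- `N ⊨ U is a Ramsey measure on κ`, for a transitive ZFC⁻-model `N`: all components are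
absolute except `ω₁`-intersectingness, which is evaluated using sequences in `N`. -/
def RamseyMeasureIn (N κ U : ZFSet) : Prop :=
  U ∈ N ∧ IsSUMeasure κ U ∧ WeaklyAmenable κ (MU κ U) U ∧ OmegaOneIntersectingIn N U

/-- `N ⊨ U is a strong Ramsey measure on κ`: closure of `M_U` under `<κ`-sequences is
evaluated using the sequences lying in `N`. -/
def StrongRamseyMeasureIn (N κ U : ZFSet) : Prop :=
  U ∈ N ∧ IsSUMeasure κ U ∧ WeaklyAmenable κ (MU κ U) U ∧
  ∀ f ∈ N.toSet, ∀ γ ∈ κ, IsZFunc γ f → (∀ a ∈ γ, fapp f a ∈ MU κ U) → f ∈ MU κ U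

/-- The class `H_{κ⁺}` as computed in `N`. -/
def HclassIn (N κ : ZFSet) : Set ZFSet := { x | x ∈ N ∧ HeredLE κ x }

/-- `N ⊨ U is a super Ramsey measure on κ`. -/
def SuperRamseyMeasureIn (N κ U : ZFSet) : Prop :=
  StrongRamseyMeasureIn N κ U ∧ ElemSub (MU κ U).toSet (HclassIn N κ)

/-- `N ⊨ U is a certified Ramsey measure on κ` (the certifying set is required to lie in `N`). -/
def CertifiedRamseyMeasureIn (N κ U : ZFSet) : Prop :=
  U ∈ N ∧ IsSUMeasure κ U ∧ WeaklyAmenable κ (MU κ U) U ∧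
  ∃ I ∈ N.toSet, Certifies κ U I.toSet

/-! ### Goodness, witness collections, and the M-order -/

/-- `U` is `A`-good: `A ∈ M_U`. -/
def AGood (κ A U : ZFSet) : Prop := A ∈ MU κ U

/-- A witness collection of `Pm`-measures on `κ`: a collection of `Pm`-measures containing
an `A`-good one for every `A ⊆ κ`. -/
def IsWitness (Pm : ZFSet → ZFSet → Prop) (κ : ZFSet) (𝒰 : Set ZFSet) : Prop :=
  (∀ U ∈ 𝒰, Pm κ U) ∧ ∀ A : ZFSet, A ⊆ κ → ∃ U ∈ 𝒰, AGood κ A U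

/-- The M-order on witness collections of `Pm`-measures on `κ`; `PmIn N κ U` is the
relativization `N ⊨ U is a Pm-measure on κ`.  `MOrder Pm PmIn κ 𝒰 𝒲` says `𝒰 ◁ 𝒲`. -/
def MOrder (Pm : ZFSet → ZFSet → Prop) (PmIn : ZFSet → ZFSet → ZFSet → Prop)
    (κ : ZFSet) (𝒰 𝒲 : Set ZFSet) : Prop :=
  IsWitness Pm κ 𝒰 ∧ IsWitness Pm κ 𝒲 ∧
  (∀ W ∈ 𝒲, ∀ A ∈ (NU κ W).toSet, A ⊆ κ →
    ∃ U ∈ 𝒰, U ∈ NU κ W ∧ AGood κ A U ∧ PmIn (NU κ W) κ U) ∧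
  (∀ U ∈ 𝒰, ∃ W ∈ 𝒲, U ∈ NU κ W)

/-! ### Ranks -/

/-- The rank of a point in an arbitrary binary relation (`0` at non-accessible points). -/
def relRank {X : Type*} (r : X → X → Prop) (x : X) : Ordinal :=
  if h : Acc r x then h.rank else 0

/-- The M-rank `o_Pm(κ)`: the strict supremum of the M-ranks of all witness collections of
`Pm`-measures on `κ` (and `0` if there are none). -/
def oRank (Pm : ZFSet → ZFSet → Prop) (PmIn : ZFSet → ZFSet → ZFSet → Prop)
    (κ : ZFSet) : Ordinal :=
  sSup { o : Ordinal |
    ∃ 𝒰 : Set ZFSet, IsWitness Pm κ 𝒰 ∧ o = relRank (MOrder Pm PmIn κ) 𝒰 + 1 }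

/-- `N ⊨ o_Pm(κ) ≥ α`, defined by the recursion: for every `A ⊆ κ` in `N` and every `β < α`
there is an `A`-good `Pm`-measure `W` in `N` (in the sense of `N`) whose ultrapower satisfies
`o_Pm(κ) ≥ β`. -/
def oGEin (PmIn : ZFSet → ZFSet → ZFSet → Prop) (κ : ZFSet) : Ordinal → ZFSet → Prop :=
  WellFounded.fix wellFounded_lt fun α ih N =>
    ∀ A ∈ N.toSet, A ⊆ κ → ∀ β, ∀ h : β < α,
      ∃ W ∈ N.toSet, PmIn N κ W ∧ AGood κ A W ∧ ih β h (NU κ W)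

/-- `N ⊨ o_Pm(κ) = α`. -/
def oEQin (PmIn : ZFSet → ZFSet → ZFSet → Prop) (κ : ZFSet) (α : Ordinal) (N : ZFSet) : Prop :=
  oGEin PmIn κ α N ∧ ¬ oGEin PmIn κ (α + 1) N

/-! ### The M-order and M-rank relativized to a model `ℳ` -/

/-- A witness collection (coded as a set) of `Pm`-measures in the sense of the model `ℳ`. -/
def IsWitnessIn (PmIn : ZFSet → ZFSet → ZFSet → Prop) (ℳ κ 𝒰 : ZFSet) : Prop :=
  𝒰 ∈ ℳ ∧ (∀ U ∈ 𝒰, PmIn ℳ κ U) ∧ ∀ A ∈ ℳ.toSet, A ⊆ κ → ∃ U ∈ 𝒰.toSet, AGood κ A U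

/-- The M-order on witness collections as computed in `ℳ`. -/
def MOrderIn (PmIn : ZFSet → ZFSet → ZFSet → Prop) (ℳ κ : ZFSet) (𝒰 𝒲 : ZFSet) : Prop :=
  IsWitnessIn PmIn ℳ κ 𝒰 ∧ IsWitnessIn PmIn ℳ κ 𝒲 ∧
  (∀ W ∈ 𝒲, ∀ A ∈ (NU κ W).toSet, A ⊆ κ →
    ∃ U ∈ 𝒰.toSet, U ∈ NU κ W ∧ AGood κ A U ∧ PmIn (NU κ W) κ U) ∧
  (∀ U ∈ 𝒰, ∃ W ∈ 𝒲.toSet, U ∈ NU κ W)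

/-- The M-rank `o_Pm(κ)` as computed in `ℳ`. -/
def oRankIn (PmIn : ZFSet → ZFSet → ZFSet → Prop) (ℳ κ : ZFSet) : Ordinal :=
  sSup { o : Ordinal |
    ∃ 𝒰 : ZFSet, IsWitnessIn PmIn ℳ κ 𝒰 ∧ o = relRank (MOrderIn PmIn ℳ κ) 𝒰 + 1 }

/-! ### Practical models, cover and approximation properties -/

/-- `ℳ` is practical for `κ`: a transitive ZFC⁻-model containing `κ` in which
`V_{κ+3}` exists. -/
def Practical (κ ℳ : ZFSet) : Prop :=
  IsTransModel ℳ ∧ κ ∈ ℳ ∧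
  ∃ v ∈ ℳ.toSet, ∀ x, x ∈ v ↔ (x ∈ ℳ ∧ ZFSet.rank x < ZFSet.rank κ + 3)

/-- `x` has size less than `δ` as witnessed inside the class `D`:
some `f ∈ D` injects `x` into an ordinal `γ ∈ δ`. -/
def SizeLTin (D : Set ZFSet) (x δ : ZFSet) : Prop :=
  ∃ γ ∈ δ.toSet, ∃ f ∈ D, IsZFunc x f ∧ MapsInto f x γ ∧ InjOnZ f x

/-- The pair `D ⊆ D'` has the `δ`-cover property. -/
def CoverProperty (δ : ZFSet) (D D' : Set ZFSet) : Prop :=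
  ∀ X ∈ D', X.toSet ⊆ D → SizeLTin D' X δ →
    ∃ Y ∈ D, X ⊆ Y ∧ SizeLTin D Y δ

/-- The pair `D ⊆ D'` has the `δ`-approximation property. -/
def ApproxProperty (δ : ZFSet) (D D' : Set ZFSet) : Prop :=
  ∀ X ∈ D', X.toSet ⊆ D → (∀ x ∈ D, SizeLTin D x δ → X ∩ x ∈ D) → X ∈ D

/-- `δ` is a cardinal from the point of view of the class `D`. -/
def IsCardIn (D : Set ZFSet) (δ : ZFSet) : Prop :=
  IsOrd δ ∧ δ ∈ D ∧ ∀ γ ∈ δ, ¬ ∃ f ∈ D, IsZFunc γ f ∧ SurjOnto f γ δ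

/-- `δ` is a regular (infinite) cardinal from the point of view of the class `D`. -/
def IsRegularIn (D : Set ZFSet) (δ : ZFSet) : Prop :=
  IsCardIn D δ ∧ ZFSet.omega ⊆ δ ∧
  ∀ γ ∈ δ, ∀ f ∈ D, IsZFunc γ f → MapsInto f γ δ →
    ∃ β ∈ δ, ∀ a ∈ γ, fapp f a ∈ β

/-- `H_λ` as computed in the model `V`: the members of `V` having, in `V`,
a transitive superset of size `< λ`. -/
def HIn (V lam : ZFSet) : Set ZFSet :=
  { x | x ∈ V ∧ ∃ t ∈ V.toSet, x ⊆ t ∧ t.IsTransitive ∧ SizeLTin V.toSet t lam }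

/-- `V` and `V'` have the same ordinals. -/
def SameOrdinals (D D' : Set ZFSet) : Prop :=
  ∀ α, IsOrd α → (α ∈ D ↔ α ∈ D')

/-- Every `ω`-sequence of elements of `ℳ` lying in `ℳ'` is an element of `ℳ`. -/
def OmegaSeqClosedPair (ℳ ℳ' : ZFSet) : Prop :=
  ∀ f ∈ ℳ'.toSet, IsZFunc ZFSet.omega f → (∀ n ∈ ZFSet.omega, fapp f n ∈ ℳ) → f ∈ ℳ

/-! ### Large cardinal properties -/

/-- `κ` is Ramsey: every `A ⊆ κ` belongs to a weak `κ`-model `M` carrying a weakly amenable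
`ω₁`-intersecting `M`-ultrafilter on `κ`. -/
def IsRamseyCard (κ : ZFSet) : Prop :=
  IsCard κ ∧ ∀ A : ZFSet, A ⊆ κ →
    ∃ M, IsWeakModel κ M ∧ A ∈ M ∧
      ∃ U, IsMUltrafilter κ M U ∧ WeaklyAmenable κ M U ∧ OmegaOneIntersecting U

/-- `κ` is strongly Ramsey: the model `M` can moreover be taken to be a `κ`-model. -/
def IsStronglyRamseyCard (κ : ZFSet) : Prop :=
  IsCard κ ∧ ∀ A : ZFSet, A ⊆ κ →
    ∃ M, IsKappaModel κ M ∧ A ∈ M ∧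
      ∃ U, IsMUltrafilter κ M U ∧ WeaklyAmenable κ M U ∧ OmegaOneIntersecting U

/-- `κ` is super Ramsey: the model `M` can moreover be taken to be a `κ`-model
elementary in `H_{κ⁺}`. -/
def IsSuperRamseyCard (κ : ZFSet) : Prop :=
  IsCard κ ∧ ∀ A : ZFSet, A ⊆ κ →
    ∃ M, IsKappaModel κ M ∧ ElemSub M.toSet (Hclass κ) ∧ A ∈ M ∧
      ∃ U, IsMUltrafilter κ M U ∧ WeaklyAmenable κ M U ∧ OmegaOneIntersecting U

/-- `κ` is weakly super Ramsey: the model `M` is a weak `κ`-model elementary in `H_{κ⁺}`. -/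
def IsWeaklySuperRamseyCard (κ : ZFSet) : Prop :=
  IsCard κ ∧ ∀ A : ZFSet, A ⊆ κ →
    ∃ M, IsWeakModel κ M ∧ ElemSub M.toSet (Hclass κ) ∧ A ∈ M ∧
      ∃ U, IsMUltrafilter κ M U ∧ WeaklyAmenable κ M U ∧ OmegaOneIntersecting U

/-- `κ` is measurable: there is a `κ`-complete nonprincipal ultrafilter on (all) subsets
of `κ`. -/
def IsMeasurableCard (κ : ZFSet) : Prop :=
  IsCard κ ∧ ZFSet.omega ∈ κ ∧
  ∃ 𝒰 : Set ZFSet,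
    (∀ A ∈ 𝒰, A ⊆ κ) ∧ (∅ : ZFSet) ∉ 𝒰 ∧ κ ∈ 𝒰 ∧
    (∀ A ∈ 𝒰, ∀ B : ZFSet, B ⊆ κ → A ⊆ B → B ∈ 𝒰) ∧
    (∀ A : ZFSet, A ⊆ κ → (A ∈ 𝒰 ∨ compl κ A ∈ 𝒰)) ∧
    (∀ γ ∈ κ.toSet, ∀ s : ZFSet → ZFSet, (∀ i ∈ γ, s i ∈ 𝒰) →
      ZFSet.sep (fun ξ => ∀ i ∈ γ, ξ ∈ s i) κ ∈ 𝒰)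

/-! ### Relativized large-cardinal properties -/

/-- `N ⊨ κ is Ramsey` (for a transitive model `N`): the witnessing models and ultrafilters
lie in `N`, smallness of the models is witnessed in `N`, and `ω₁`-intersectingness is
evaluated using the sequences in `N`. -/
def RamseyCardIn (N κ : ZFSet) : Prop :=
  ∀ A ∈ N.toSet, A ⊆ κ →
    ∃ M ∈ N.toSet, A ∈ M ∧ IsTransModel M ∧ κ ∈ M ∧
      (∃ f ∈ N.toSet, IsZFunc κ f ∧ SurjOnto f κ M) ∧
      ∃ U ∈ N.toSet, IsMUltrafilter κ M U ∧ WeaklyAmenable κ M U ∧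
        OmegaOneIntersectingIn N U

/-- `N ⊨ κ is strongly Ramsey`. -/
def StronglyRamseyCardIn (N κ : ZFSet) : Prop :=
  ∀ A ∈ N.toSet, A ⊆ κ →
    ∃ M ∈ N.toSet, A ∈ M ∧ IsTransModel M ∧ κ ∈ M ∧
      (∃ f ∈ N.toSet, IsZFunc κ f ∧ SurjOnto f κ M) ∧
      (∀ f ∈ N.toSet, ∀ γ ∈ κ, IsZFunc γ f → (∀ a ∈ γ, fapp f a ∈ M) → f ∈ M) ∧
      ∃ U ∈ N.toSet, IsMUltrafilter κ M U ∧ WeaklyAmenable κ M U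

/-- `N ⊨ κ is super Ramsey`. -/
def SuperRamseyCardIn (N κ : ZFSet) : Prop :=
  ∀ A ∈ N.toSet, A ⊆ κ →
    ∃ M ∈ N.toSet, A ∈ M ∧ IsTransModel M ∧ κ ∈ M ∧
      (∃ f ∈ N.toSet, IsZFunc κ f ∧ SurjOnto f κ M) ∧
      (∀ f ∈ N.toSet, ∀ γ ∈ κ, IsZFunc γ f → (∀ a ∈ γ, fapp f a ∈ M) → f ∈ M) ∧
      ElemSub M.toSet (HclassIn N κ) ∧
      ∃ U ∈ N.toSet, IsMUltrafilter κ M U ∧ WeaklyAmenable κ M U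

/-! ### ω-special models -/

/-- A weak `κ`-model `M` is `ω`-special: it is the union of a chain
`M₀ ≺ M₁ ≺ ⋯` of elementary substructures of `M` with each `Mₙ ∈ M` and `|Mₙ|^M = κ`. -/
def OmegaSpecial (κ M : ZFSet) : Prop :=
  ∃ s : ℕ → ZFSet,
    (∀ n, s n ∈ M) ∧
    (∀ n, (s n).toSet ⊆ (s (n + 1)).toSet) ∧
    (∀ n, ElemSub (s n).toSet M.toSet) ∧
    (∀ n, ∃ f ∈ M.toSet, IsBij f κ (s n)) ∧
    (∀ x, x ∈ M ↔ ∃ n, x ∈ s n)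

/-! ### Iterated ultrapowers and α-iterability -/

/-- `U` is an `α`-iterable `M`-ultrafilter on `κ`: there is a coherent system of transitive
models `Mod β` (`β ≤ α`), with commuting elementary embeddings `e β γ : Mod β → Mod γ`,
critical sequence `cr β` and ultrafilter sequence `Us β`, starting at `(M, κ, U)`, where each
successor step is given by an ultrapower and each limit step is a (collapsed) direct limit. -/
def IsAlphaIterable (κ M U : ZFSet) (α : Ordinal) : Prop :=
  ∃ (Mod : Ordinal → ZFSet) (cr : Ordinal → ZFSet) (Us : Ordinal → ZFSet)
    (e : Ordinal → Ordinal → ZFSet → ZFSet),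
    Mod 0 = M ∧ cr 0 = κ ∧ Us 0 = U ∧
    (∀ β ≤ α, (Mod β).IsTransitive) ∧
    (∀ β ≤ α, ∀ x ∈ Mod β, e β β x = x) ∧
    (∀ β γ ρ : Ordinal, β ≤ γ → γ ≤ ρ → ρ ≤ α →
      ∀ x ∈ Mod β, e γ ρ (e β γ x) = e β ρ x) ∧
    (∀ β γ : Ordinal, β ≤ γ → γ ≤ α →
      (∀ x ∈ Mod β, e β γ x ∈ Mod γ) ∧
      ∀ (φ : Fml) (v : ℕ → ZFSet), (∀ n, v n ∈ Mod β) →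
        (Sat (Mod β).toSet φ v ↔ Sat (Mod γ).toSet φ (fun n => e β γ (v n)))) ∧
    (∀ β : Ordinal, β + 1 ≤ α →
      IsUltrapowerEmb (cr β) (Mod β) (Us β) (Mod (β + 1)) (e β (β + 1)) ∧
      cr (β + 1) = e β (β + 1) (cr β) ∧
      (∀ A, A ∈ Us (β + 1) ↔
        ∃ X ∈ (Mod β).toSet, X ∩ Us β ∈ Mod β ∧ A ∈ e β (β + 1) (X ∩ Us β))) ∧
    (∀ lam : Ordinal, lam ≤ α → lam ≠ 0 → (∀ β < lam, β + 1 < lam) →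
      (∀ x ∈ Mod lam, ∃ β < lam, ∃ y ∈ (Mod β).toSet, e β lam y = x) ∧
      cr lam = e 0 lam κ ∧
      (∀ A, A ∈ Us lam ↔ ∃ β < lam, ∃ B, B ∈ Us β ∧ e β lam B = A))

/-- `N ⊨ κ is α-iterable`: every `A ⊆ κ` in `N` belongs to a weak `κ`-model `M ∈ N` for
which there is a weakly amenable `α`-iterable `M`-ultrafilter `U ∈ N` on `κ`. -/
def AlphaIterableCardIn (N κ : ZFSet) (α : Ordinal) : Prop :=
  ∀ A ∈ N.toSet, A ⊆ κ →
    ∃ M ∈ N.toSet, A ∈ M ∧ IsTransModel M ∧ κ ∈ M ∧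
      (∃ f ∈ N.toSet, IsZFunc κ f ∧ SurjOnto f κ M) ∧
      ∃ U ∈ N.toSet, IsMUltrafilter κ M U ∧ WeaklyAmenable κ M U ∧
        IsAlphaIterable κ M U α

/-! ### Forcing -/

/-- `R` codes a partial order (of forcing conditions) on `P`: `pair p q ∈ R` means `p ≤ q`. -/
def IsPoset (P R : ZFSet) : Prop :=
  (∀ p ∈ R, ∃ a ∈ P, ∃ b ∈ P, p = ZFSet.pair a b) ∧
  (∀ p ∈ P, ZFSet.pair p p ∈ R) ∧
  (∀ p ∈ P, ∀ q ∈ P, ∀ r ∈ P,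
    ZFSet.pair p q ∈ R → ZFSet.pair q r ∈ R → ZFSet.pair p r ∈ R)

/-- `G` is an `ℳ`-generic filter on the poset `(P, R)`. -/
def IsGenericFilter (ℳ P R : ZFSet) (G : Set ZFSet) : Prop :=
  G ⊆ P.toSet ∧ G.Nonempty ∧
  (∀ p ∈ G, ∀ q ∈ G, ∃ r ∈ G, ZFSet.pair r p ∈ R ∧ ZFSet.pair r q ∈ R) ∧
  (∀ p ∈ G, ∀ q ∈ P.toSet, ZFSet.pair p q ∈ R → q ∈ G) ∧
  ∀ Dset ∈ ℳ.toSet, Dset ⊆ P →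
    (∀ p ∈ P.toSet, ∃ q ∈ Dset.toSet, ZFSet.pair q p ∈ R) →
    ∃ q ∈ G, q ∈ Dset

/-- `ℳ'` is the generic extension `ℳ[G]`: the least transitive ZFC⁻-model containing `ℳ`
and (a set coding) `G`, with the same ordinals as `ℳ`. -/
def IsGenericExt (ℳ ℳ' : ZFSet) (G : Set ZFSet) : Prop :=
  IsTransModel ℳ' ∧ ℳ ⊆ ℳ' ∧ (∃ g ∈ ℳ'.toSet, g.toSet = G) ∧
  SameOrdinals ℳ.toSet ℳ'.toSet ∧
  ∀ N', IsTransModel N' → ℳ ⊆ N' → (∃ g ∈ N'.toSet, g.toSet = G) → ℳ' ⊆ N'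

/-- `f ∈ D` is a cofinal map from `γ` into the ordinal `α`. -/
def CofinalMapIn (D : Set ZFSet) (γ α f : ZFSet) : Prop :=
  f ∈ D ∧ IsZFunc γ f ∧ MapsInto f γ α ∧
  ∀ b ∈ α, ∃ a ∈ γ, b ∈ fapp f a ∨ b = fapp f a

/-- `γ` is the cofinality of the ordinal `α` as computed in `D`. -/
def IsCofIn (D : Set ZFSet) (α γ : ZFSet) : Prop :=
  IsOrd γ ∧ (∃ f, CofinalMapIn D γ α f) ∧ ∀ γ' ∈ γ, ¬ ∃ f, CofinalMapIn D γ' α f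

/-- The pair `ℳ ⊆ ℳ'` preserves all cofinalities. -/
def PreservesCofinalities (ℳ ℳ' : ZFSet) : Prop :=
  ∀ α ∈ ℳ.toSet, IsOrd α → ∀ γ, (IsCofIn ℳ.toSet α γ ↔ IsCofIn ℳ'.toSet α γ)

/-! ### Internal definability -/

section Internal

/-- The elements of a model, as a type. -/
abbrev El (M : ZFSet) := {x : ZFSet // x ∈ M}

/-- Satisfaction with valuations taking values in the model. -/
def SatE {M : ZFSet} (φ : Fml) (v : ℕ → El M) : Prop := Sat M.toSet φ (fun n => (v n).1)

def fAnd (φ ψ : Fml) : Fml := .neg (.impl φ (.neg ψ))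
def fOr (φ ψ : Fml) : Fml := .impl (.neg φ) ψ
def fIff (φ ψ : Fml) : Fml := fAnd (.impl φ ψ) (.impl ψ φ)
def fEx (n : ℕ) (φ : Fml) : Fml := .neg (.all n (.neg φ))

variable {M : ZFSet}

theorem SatE_mem (i j : ℕ) (v : ℕ → El M) : SatE (.mem i j) v ↔ (v i).1 ∈ (v j).1 := Iff.rfl

theorem SatE_eq (i j : ℕ) (v : ℕ → El M) : SatE (.eq i j) v ↔ v i = v j := by
  unfold SatE; simp only [Sat]; exact Subtype.ext_iff.symm

theorem SatE_impl (φ ψ : Fml) (v : ℕ → El M) :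
    SatE (.impl φ ψ) v ↔ (SatE φ v → SatE ψ v) := Iff.rfl

theorem SatE_neg (φ : Fml) (v : ℕ → El M) : SatE (.neg φ) v ↔ ¬ SatE φ v := Iff.rfl

theorem coe_update (v : ℕ → El M) (n : ℕ) (x : El M) :
    (fun k => ((Function.update v n x) k).1) = Function.update (fun k => (v k).1) n x.1 := by
  funext k
  by_cases h : k = n
  · subst h; simp
  · simp [h]

theorem SatE_all (n : ℕ) (φ : Fml) (v : ℕ → El M) :
    SatE (.all n φ) v ↔ ∀ x : El M, SatE φ (Function.update v n x) := by
  unfold SatE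
  simp only [Sat, coe_update]
  exact ⟨fun h x => h x.1 x.2, fun h x hx => h ⟨x, hx⟩⟩

theorem SatE_and (φ ψ : Fml) (v : ℕ → El M) : SatE (fAnd φ ψ) v ↔ (SatE φ v ∧ SatE ψ v) := by
  simp only [fAnd, SatE_neg, SatE_impl]; tauto

theorem SatE_or (φ ψ : Fml) (v : ℕ → El M) : SatE (fOr φ ψ) v ↔ (SatE φ v ∨ SatE ψ v) := by
  simp only [fOr, SatE_neg, SatE_impl]; tauto

theorem SatE_iff (φ ψ : Fml) (v : ℕ → El M) : SatE (fIff φ ψ) v ↔ (SatE φ v ↔ SatE ψ v) := by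
  simp only [fIff, SatE_and, SatE_impl]; tauto

theorem SatE_ex (n : ℕ) (φ : Fml) (v : ℕ → El M) :
    SatE (fEx n φ) v ↔ ∃ x : El M, SatE φ (Function.update v n x) := by
  simp only [fEx, SatE_neg, SatE_all, not_forall, not_not]

variable (hM : IsTransModel M)
include hM

theorem tr_mem {x y : ZFSet} (hy : y ∈ M) (hx : x ∈ y) : x ∈ M := hM.1 y hy hx

theorem upair_mem {x y : ZFSet} (hx : x ∈ M) (hy : y ∈ M) : ({x, y} : ZFSet) ∈ M :=
  hM.2.2.1 x hx y hy

theorem sing_mem {x : ZFSet} (hx : x ∈ M) : ({x} : ZFSet) ∈ M := by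
  have := upair_mem hM hx hx
  rwa [ZFSet.pair_eq_singleton] at this

theorem pair_mem {x y : ZFSet} (hx : x ∈ M) (hy : y ∈ M) : ZFSet.pair x y ∈ M :=
  upair_mem hM (sing_mem hM hx) (upair_mem hM hx hy)

theorem sUnion_mem {x : ZFSet} (hx : x ∈ M) : (⋃₀ x : ZFSet) ∈ M := hM.2.2.2.1 x hx

theorem union_mem {x y : ZFSet} (hx : x ∈ M) (hy : y ∈ M) : x ∪ y ∈ M :=
  sUnion_mem hM (upair_mem hM hx hy)

theorem of_pair_mem {x y p : ZFSet} (hp : p ∈ M) (h : ZFSet.pair x y ∈ p) : x ∈ M ∧ y ∈ M := by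
  have h1 := tr_mem hM hp h
  have h2 : ({x, y} : ZFSet) ∈ M := tr_mem hM h1 (by simp [ZFSet.pair])
  exact ⟨tr_mem hM h2 (by simp), tr_mem hM h2 (by simp)⟩

theorem ext_M {x y : ZFSet} (hx : x ∈ M) (hy : y ∈ M)
    (h : ∀ z : El M, z.1 ∈ x ↔ z.1 ∈ y) : x = y := by
  ext z
  exact ⟨fun hz => (h ⟨z, tr_mem hM hx hz⟩).1 hz, fun hz => (h ⟨z, tr_mem hM hy hz⟩).2 hz⟩

theorem sep_mem {P : ZFSet → Prop} {a : ZFSet} (ha : a ∈ M) (φ : Fml) (v : ℕ → El M)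
    (h : ∀ x : El M, SatE φ (Function.update v 0 x) ↔ P x.1) : ZFSet.sep P a ∈ M := by
  obtain ⟨b, hb, hb'⟩ := hM.2.2.2.2.1 φ (fun n => (v n).1) (fun n => (v n).2) a ha
  have : ZFSet.sep P a = b := by
    ext x
    rw [hb', ZFSet.mem_sep]
    refine and_congr_right fun hx => ?_
    rw [← h ⟨x, tr_mem hM ha hx⟩, SatE, coe_update]
  rwa [this]

theorem coll_mem {Q : ZFSet → ZFSet → Prop} {a : ZFSet} (ha : a ∈ M) (φ : Fml) (v : ℕ → El M)
    (h : ∀ x y : El M, SatE φ (Function.update (Function.update v 0 x) 1 y) ↔ Q x.1 y.1)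
    (hex : ∀ x ∈ a, ∃ y ∈ M, Q x y) : ∃ b ∈ M, ∀ x ∈ a, ∃ y ∈ b, Q x y := by
  have key : ∀ x y : El M, Sat M.toSet φ
      (Function.update (Function.update (fun n => (v n).1) 0 x.1) 1 y.1) ↔ Q x.1 y.1 := by
    intro x y
    rw [← h x y, SatE, coe_update, coe_update]
  obtain ⟨b, hb, hb'⟩ := hM.2.2.2.2.2.1 φ (fun n => (v n).1) (fun n => (v n).2) a ha (by
    intro x hx
    obtain ⟨y, hy, hxy⟩ := hex x hx
    exact ⟨y, hy, (key ⟨x, tr_mem hM ha hx⟩ ⟨y, hy⟩).2 hxy⟩)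
  refine ⟨b, hb, fun x hx => ?_⟩
  obtain ⟨y, hy, hxy⟩ := hb' x hx
  exact ⟨y, hy, (key ⟨x, tr_mem hM ha hx⟩ ⟨y, tr_mem hM hb hy⟩).1 hxy⟩

omit hM in
/-- `v i = {v j, v k}` -/
def fUpair (i j k : ℕ) : Fml :=
  .all (i + j + k + 1) (fIff (.mem (i + j + k + 1) i)
    (fOr (.eq (i + j + k + 1) j) (.eq (i + j + k + 1) k)))

theorem SatE_upair (i j k : ℕ) (v : ℕ → El M) :
    SatE (fUpair i j k) v ↔ (v i).1 = {(v j).1, (v k).1} := by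
  have h1 : i ≠ i + j + k + 1 := by omega
  have h2 : j ≠ i + j + k + 1 := by omega
  have h3 : k ≠ i + j + k + 1 := by omega
  simp only [fUpair, SatE_all, SatE_iff, SatE_or, SatE_mem, SatE_eq, Function.update_self,
    Function.update_of_ne h1, Function.update_of_ne h2, Function.update_of_ne h3]
  constructor
  · intro h
    apply ext_M hM (v i).2 (upair_mem hM (v j).2 (v k).2)
    intro z
    rw [h z, ZFSet.mem_pair, Subtype.ext_iff, Subtype.ext_iff]
  · intro h z
    rw [h, ZFSet.mem_pair, Subtype.ext_iff, Subtype.ext_iff]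

omit hM in
/-- `v i = pair (v j) (v k)` -/
def fPair (i j k : ℕ) : Fml :=
  fEx (i + j + k + 1) (fEx (i + j + k + 2) (fAnd (fUpair (i + j + k + 1) j j)
    (fAnd (fUpair (i + j + k + 2) j k) (fUpair i (i + j + k + 1) (i + j + k + 2)))))

theorem SatE_pair (i j k : ℕ) (v : ℕ → El M) :
    SatE (fPair i j k) v ↔ (v i).1 = ZFSet.pair (v j).1 (v k).1 := by
  have h1 : i ≠ i + j + k + 1 := by omega
  have h2 : j ≠ i + j + k + 1 := by omega
  have h3 : k ≠ i + j + k + 1 := by omega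
  have h4 : i ≠ i + j + k + 2 := by omega
  have h5 : j ≠ i + j + k + 2 := by omega
  have h6 : k ≠ i + j + k + 2 := by omega
  have h7 : i + j + k + 1 ≠ i + j + k + 2 := by omega
  simp only [fPair, SatE_ex, SatE_and, SatE_upair hM, Function.update_self,
    Function.update_of_ne h1, Function.update_of_ne h2, Function.update_of_ne h3,
    Function.update_of_ne h4, Function.update_of_ne h5, Function.update_of_ne h6,
    Function.update_of_ne h7]
  constructor
  · rintro ⟨x, y, hx, hy, hi⟩
    rw [hi, hx, hy, ZFSet.pair_eq_singleton]; rfl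
  · intro h
    exact ⟨⟨_, sing_mem hM (v j).2⟩, ⟨_, upair_mem hM (v j).2 (v k).2⟩,
      (ZFSet.pair_eq_singleton _).symm, rfl, h⟩

omit hM in
/-- `pair (v i) (v j) ∈ v k` -/
def fPM (i j k : ℕ) : Fml :=
  fEx (i + j + k + 1) (fAnd (fPair (i + j + k + 1) i j) (.mem (i + j + k + 1) k))

theorem SatE_pm (i j k : ℕ) (v : ℕ → El M) :
    SatE (fPM i j k) v ↔ ZFSet.pair (v i).1 (v j).1 ∈ (v k).1 := by
  have h1 : i ≠ i + j + k + 1 := by omega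
  have h2 : j ≠ i + j + k + 1 := by omega
  have h3 : k ≠ i + j + k + 1 := by omega
  simp only [fPM, SatE_ex, SatE_and, SatE_pair hM, SatE_mem, Function.update_self,
    Function.update_of_ne h1, Function.update_of_ne h2, Function.update_of_ne h3]
  constructor
  · rintro ⟨x, hx, hxk⟩
    rwa [← hx]
  · intro h
    exact ⟨⟨_, pair_mem hM (v i).2 (v j).2⟩, rfl, h⟩

/-- A superset of the product of two sets. -/
theorem exists_prod {a b : ZFSet} (ha : a ∈ M) (hb : b ∈ M) :
    ∃ P ∈ M, ∀ x ∈ a, ∀ y ∈ b, ZFSet.pair x y ∈ P := by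
  obtain ⟨C, hC, hC'⟩ := coll_mem hM (Q := fun x B => ∀ y ∈ b, ZFSet.pair x y ∈ B) ha
    (.all 3 (.impl (.mem 3 2) (fPM 0 3 1))) (fun _ => ⟨b, hb⟩) (by
      intro x B
      simp [SatE_all, SatE_impl, SatE_mem, SatE_pm hM]
      exact ⟨fun h y hy => h y (tr_mem hM hb hy) hy, fun h y _ hy => h y hy⟩) (by
      intro x hx
      have hxM := tr_mem hM ha hx
      obtain ⟨B, hB, hB'⟩ := coll_mem hM (Q := fun y q => q = ZFSet.pair x y) hb
        (fPair 1 2 0) (fun _ => ⟨x, hxM⟩) (by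
          intro y q
          simp [SatE_pair hM])
        (fun y hy => ⟨_, pair_mem hM hxM (tr_mem hM hb hy), rfl⟩)
      refine ⟨B, hB, fun y hy => ?_⟩
      obtain ⟨q, hq, rfl⟩ := hB' y hy
      exact hq)
  refine ⟨_, sUnion_mem hM hC, fun x hx y hy => ?_⟩
  obtain ⟨B, hB, h⟩ := hC' x hx
  exact ZFSet.mem_sUnion.2 ⟨B, hB, h y hy⟩

/-- Definable relations between two sets of the model are in the model. -/
theorem rel_mem {R : ZFSet → ZFSet → Prop} {a b : ZFSet} (ha : a ∈ M) (hb : b ∈ M)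
    (φ : Fml) (v : ℕ → El M)
    (h : ∀ q x y : El M, SatE φ (Function.update (Function.update (Function.update v 0 q) 1 x) 2 y)
      ↔ R x.1 y.1) :
    ∃ g ∈ M, (∀ x y, ZFSet.pair x y ∈ g ↔ x ∈ a ∧ y ∈ b ∧ R x y) ∧
      ∀ p ∈ g, ∃ x ∈ a, ∃ y ∈ b, p = ZFSet.pair x y := by
  obtain ⟨P, hP, hP'⟩ := exists_prod hM ha hb
  have h1 : ZFSet.sep (fun q => ∃ x ∈ M, ∃ y ∈ M, q = ZFSet.pair x y ∧ R x y) P ∈ M := by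
    refine sep_mem hM hP (fEx 1 (fEx 2 (fAnd (fPair 0 1 2) φ))) v ?_
    intro q
    simp only [SatE_ex, SatE_and, SatE_pair hM, h]
    simp
    exact ⟨fun ⟨x, hx, y, h, hy, hR⟩ => ⟨x, hx, y, hy, h, hR⟩,
      fun ⟨x, hx, y, hy, h, hR⟩ => ⟨x, hx, y, h, hy, hR⟩⟩
  -- cut down to `a × b`
  have h2 : ZFSet.sep (fun q => ∃ x ∈ a, ∃ y ∈ b, q = ZFSet.pair x y)
      (ZFSet.sep (fun q => ∃ x ∈ M, ∃ y ∈ M, q = ZFSet.pair x y ∧ R x y) P) ∈ M := by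
    refine sep_mem hM h1 (fEx 1 (fAnd (.mem 1 3) (fEx 2 (fAnd (.mem 2 4) (fPair 0 1 2)))))
      (Function.update (fun _ => ⟨a, ha⟩) 4 ⟨b, hb⟩) ?_
    intro q
    simp [SatE_ex, SatE_and, SatE_mem, SatE_pair hM]
    exact ⟨fun ⟨x, hx, _, y, hy, _, h⟩ => ⟨x, ‹_›, y, ‹_›, h⟩,
      fun ⟨x, hx, y, hy, h⟩ => ⟨x, hx, tr_mem hM ha hx, y, hy, tr_mem hM hb hy, h⟩⟩
  refine ⟨_, h2, ?_, ?_⟩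
  · intro x y
    simp only [ZFSet.mem_sep, ZFSet.pair_inj]
    constructor
    · rintro ⟨⟨_, x', _, y', _, ⟨rfl, rfl⟩, hR⟩, x2, hx2, y2, hy2, rfl, rfl⟩
      exact ⟨hx2, hy2, hR⟩
    · rintro ⟨hx, hy, hR⟩
      exact ⟨⟨hP' x hx y hy, x, tr_mem hM ha hx, y, tr_mem hM hb hy, ⟨rfl, rfl⟩, hR⟩,
        x, hx, y, hy, rfl, rfl⟩
  · intro p hp
    exact (ZFSet.mem_sep.1 hp).2

end Internal

/-! ### Ordinals and smallness -/

section Smallness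

theorem IsOrd.isOrdinal {x : ZFSet} (h : IsOrd x) : x.IsOrdinal :=
  ZFSet.isOrdinal_iff_forall_mem_isTransitive.2 h

/-- `x` is small: every partial function of the model from `x` to `lam` is bounded. -/
def Small' (M lam x : ZFSet) : Prop :=
  ∀ h ∈ M, (∀ a ∈ x, ∀ ξ ∈ lam, ∀ ξ' ∈ lam, ZFSet.pair a ξ ∈ h → ZFSet.pair a ξ' ∈ h → ξ = ξ') →
    ∃ β ∈ lam, ∀ a ∈ x, ∀ ξ ∈ lam, ZFSet.pair a ξ ∈ h → ξ ∈ β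

theorem fapp_eq {d f a b : ZFSet} (hf : IsZFunc d f) (ha : a ∈ d) (h : ZFSet.pair a b ∈ f) :
    fapp f a = b := by
  have : ZFSet.sep (fun b => ZFSet.pair a b ∈ f) (⋃₀ (⋃₀ f)) = {b} := by
    ext z
    rw [ZFSet.mem_sep, ZFSet.mem_singleton]
    constructor
    · rintro ⟨_, hz⟩
      exact (hf.2 a ha).unique hz h
    · rintro rfl
      refine ⟨ZFSet.mem_sUnion.2 ⟨{a, z}, ZFSet.mem_sUnion.2 ⟨_, h, ?_⟩, ?_⟩, h⟩
      · simp [ZFSet.pair]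
      · simp
  rw [fapp, this, ZFSet.sUnion_singleton]

theorem fapp_mem {d f a : ZFSet} (hf : IsZFunc d f) (ha : a ∈ d) :
    ZFSet.pair a (fapp f a) ∈ f := by
  obtain ⟨b, hb, _⟩ := hf.2 a ha
  rwa [fapp_eq hf ha hb]

/-- The facts about `lam` used below. -/
structure Reg (M lam : ZFSet) : Prop where
  ord : lam.IsOrdinal
  mem : lam ∈ M
  omega : ZFSet.omega ⊆ lam
  bdd : ∀ γ ∈ lam, ∀ f ∈ M, IsZFunc γ f → MapsInto f γ lam → ∃ β ∈ lam, ∀ a ∈ γ, fapp f a ∈ β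

variable {M lam : ZFSet} (hM : IsTransModel M) (hl : Reg M lam)

include hM hl

/-- Definable partial functions from a small set to `lam` are bounded. -/
theorem small_def {R : ZFSet → ZFSet → Prop} {x : ZFSet} (hxM : x ∈ M) (hx : Small' M lam x)
    (φ : Fml) (v : ℕ → El M)
    (h : ∀ q x y : El M, SatE φ (Function.update (Function.update (Function.update v 0 q) 1 x) 2 y)
      ↔ R x.1 y.1)
    (hR : ∀ a ∈ x, ∀ ξ ∈ lam, ∀ ξ' ∈ lam, R a ξ → R a ξ' → ξ = ξ') :
    ∃ β ∈ lam, ∀ a ∈ x, ∀ ξ ∈ lam, R a ξ → ξ ∈ β := by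
  obtain ⟨g, hg, hg', _⟩ := rel_mem hM hxM hl.mem φ v h
  obtain ⟨β, hβ, hb⟩ := hx g hg (by
    intro a ha ξ hξ ξ' hξ' h1 h2
    exact hR a ha ξ hξ ξ' hξ' ((hg' _ _).1 h1).2.2 ((hg' _ _).1 h2).2.2)
  exact ⟨β, hβ, fun a ha ξ hξ h => hb a ha ξ hξ ((hg' _ _).2 ⟨ha, hξ, h⟩)⟩

theorem small_subset {x y : ZFSet} (hxM : x ∈ M) (hyM : y ∈ M) (hy : Small' M lam y) (hxy : x ⊆ y) :
    Small' M lam x := by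
  intro h hh hf
  obtain ⟨β, hβ, hb⟩ := small_def hM hl (R := fun a ξ => a ∈ x ∧ ZFSet.pair a ξ ∈ h) hyM hy
    (fAnd (.mem 1 3) (fPM 1 2 4)) (Function.update (fun _ => ⟨x, hxM⟩) 4 ⟨h, hh⟩)
    (by intro q a ξ
        simp [SatE_and, SatE_mem, SatE_pm hM])
    (by rintro a - ξ hξ ξ' hξ' ⟨ha, h1⟩ ⟨_, h2⟩
        exact hf a ha ξ hξ ξ' hξ' h1 h2)
  exact ⟨β, hβ, fun a ha ξ hξ h => hb a (hxy ha) ξ hξ ⟨ha, h⟩⟩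

/-- Elements of `lam` are small. -/
theorem small_of_mem {γ : ZFSet} (hγ : γ ∈ lam) : Small' M lam γ := by
  intro h hh hf
  have hγM := tr_mem hM hl.mem hγ
  have h0 : (∅ : ZFSet) ∈ lam := hl.omega ZFSet.omega_zero
  obtain ⟨g, hg, hg', hgp⟩ := rel_mem hM (R := fun η ξ => ZFSet.pair η ξ ∈ h ∨
      ((∀ z ∈ M, z ∉ ξ) ∧ ∀ ξ' ∈ M, ξ' ∈ lam → ZFSet.pair η ξ' ∉ h)) hγM hl.mem
    (fOr (fPM 1 2 3) (fAnd (.all 5 (.neg (.mem 5 2)))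
      (.all 5 (.impl (.mem 5 4) (.neg (fPM 1 5 3))))))
    (Function.update (fun _ => ⟨h, hh⟩) 4 ⟨lam, hl.mem⟩)
    (by intro q a ξ
        simp [SatE_and, SatE_or, SatE_all, SatE_neg, SatE_impl, SatE_mem, SatE_pm hM])
  have hfun : IsZFunc γ g := by
    refine ⟨fun p hp => ?_, fun a ha => ?_⟩
    · obtain ⟨x, hx, y, _, h⟩ := hgp p hp
      exact ⟨x, hx, y, h⟩
    · by_cases hex : ∃ ξ ∈ lam, ZFSet.pair a ξ ∈ h
      · obtain ⟨ξ, hξ, h1⟩ := hex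
        refine ⟨ξ, (hg' _ _).2 ⟨ha, hξ, Or.inl h1⟩, fun y hy => ?_⟩
        obtain ⟨_, hyl, h2 | ⟨_, h2⟩⟩ := (hg' _ _).1 hy
        · exact hf a ha y hyl ξ hξ h2 h1
        · exact (h2 ξ (tr_mem hM hl.mem hξ) hξ h1).elim
      · refine ⟨∅, (hg' _ _).2 ⟨ha, h0, Or.inr ⟨by simp, ?_⟩⟩, fun y hy => ?_⟩
        · intro ξ _ hξ h1
          exact hex ⟨ξ, hξ, h1⟩
        · obtain ⟨_, hyl, h2 | ⟨h2, _⟩⟩ := (hg' _ _).1 hy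
          · exact (hex ⟨y, hyl, h2⟩).elim
          · rw [ZFSet.eq_empty]
            intro z hz
            exact h2 z (tr_mem hM (tr_mem hM hl.mem hyl) hz) hz
  obtain ⟨β, hβ, hb⟩ := hl.bdd γ hγ g hg hfun
    (fun a ha => ((hg' _ _).1 (fapp_mem hfun ha)).2.1)
  refine ⟨β, hβ, fun a ha ξ hξ h1 => ?_⟩
  have := hb a ha
  rwa [fapp_eq hfun ha ((hg' _ _).2 ⟨ha, hξ, Or.inl h1⟩)] at this

theorem small_of_size {x : ZFSet} (hxM : x ∈ M) (h : SizeLTin M.toSet x lam) : Small' M lam x := by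
  obtain ⟨γ, hγ, f, hf, hfun, hmap, hinj⟩ := h
  have hγ : γ ∈ lam := hγ
  have hf : f ∈ M := hf
  intro h hh hh'
  have key : ∀ a ∈ x, ∀ a' ∈ x, ∀ η, ZFSet.pair a η ∈ f → ZFSet.pair a' η ∈ f → a = a' := by
    intro a ha a' ha' η h1 h2
    apply hinj a ha a' ha'
    rw [fapp_eq hfun ha h1, fapp_eq hfun ha' h2]
  obtain ⟨β, hβ, hb⟩ := small_def hM hl
    (R := fun η ξ => ∃ a ∈ M, a ∈ x ∧ ZFSet.pair a η ∈ f ∧ ZFSet.pair a ξ ∈ h)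
    (tr_mem hM hl.mem hγ) (small_of_mem hM hl hγ)
    (fEx 6 (fAnd (.mem 6 3) (fAnd (fPM 6 1 4) (fPM 6 2 5))))
    (Function.update (Function.update (fun _ => ⟨x, hxM⟩) 4 ⟨f, hf⟩) 5 ⟨h, hh⟩)
    (by intro q a ξ
        simp [SatE_and, SatE_ex, SatE_mem, SatE_pm hM]
        exact exists_congr fun _ => by tauto)
    (by rintro η - ξ hξ ξ' hξ' ⟨a, _, ha, h1, h2⟩ ⟨a', _, ha', h3, h4⟩
        obtain rfl := key a ha a' ha' η h1 h3
        exact hh' a ha ξ hξ ξ' hξ' h2 h4)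
  refine ⟨β, hβ, fun a ha ξ hξ h1 => hb (fapp f a) (hmap a ha) ξ hξ
    ⟨a, tr_mem hM hxM ha, ha, fapp_mem hfun ha, h1⟩⟩

theorem max_mem {α β : ZFSet} (hα : α ∈ lam) (hβ : β ∈ lam) :
    ∃ γ ∈ lam, α ⊆ γ ∧ β ⊆ γ := by
  rcases (hl.ord.mem hα).subset_total (hl.ord.mem hβ) with h | h
  · exact ⟨β, hβ, h, fun _ h => h⟩
  · exact ⟨α, hα, fun _ h => h, h⟩

theorem small_union {x y : ZFSet} (hx : Small' M lam x) (hy : Small' M lam y) :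
    Small' M lam (x ∪ y) := by
  intro h hh hf
  obtain ⟨α, hα, h1⟩ := hx h hh (fun a ha => hf a (ZFSet.mem_union.2 (Or.inl ha)))
  obtain ⟨β, hβ, h2⟩ := hy h hh (fun a ha => hf a (ZFSet.mem_union.2 (Or.inr ha)))
  obtain ⟨γ, hγ, h3, h4⟩ := max_mem hM hl hα hβ
  refine ⟨γ, hγ, fun a ha ξ hξ h => ?_⟩
  rcases ZFSet.mem_union.1 ha with ha | ha
  · exact h3 (h1 a ha ξ hξ h)
  · exact h4 (h2 a ha ξ hξ h)

theorem small_sing {x : ZFSet} (hxM : x ∈ M) : Small' M lam {x} := by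
  intro h hh hf
  have h1 : insert ∅ ∅ ∈ lam := hl.omega (ZFSet.omega_succ ZFSet.omega_zero)
  obtain ⟨β, hβ, hb⟩ := small_def hM hl
    (R := fun η ξ => ZFSet.pair x ξ ∈ h)
    (tr_mem hM hl.mem h1) (small_of_mem hM hl h1) (fPM 3 2 4)
    (Function.update (fun _ => ⟨x, hxM⟩) 4 ⟨h, hh⟩)
    (by intro q a ξ
        simp [SatE_pm hM])
    (by intro η _ ξ hξ ξ' hξ' h1 h2
        exact hf x (by simp) ξ hξ ξ' hξ' h1 h2)
  refine ⟨β, hβ, fun a ha ξ hξ h1 => hb ∅ (by simp) ξ hξ ?_⟩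
  rw [ZFSet.mem_singleton] at ha
  rwa [← ha]

theorem small_upair {x y : ZFSet} (hxM : x ∈ M) (hyM : y ∈ M) : Small' M lam {x, y} := by
  have := small_union hM hl (small_sing hM hl hxM) (small_sing hM hl hyM)
  have e : ({x} ∪ {y} : ZFSet) = {x, y} := by ext z; simp
  rwa [e] at this

end Smallness

/-! ### The Mostowski collapse of a well-order inside the model -/

section Collapse

/-- `p` is a partial collapse of the relation `r` on `x`. -/
def Att (x r p : ZFSet) : Prop :=
  ∀ u y, ZFSet.pair u y ∈ p → u ∈ x ∧
    (∀ w ∈ x, ZFSet.pair w u ∈ r → ∃ z, ZFSet.pair w z ∈ p) ∧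
    ∀ z, z ∈ y ↔ ∃ w ∈ x, ZFSet.pair w u ∈ r ∧ ZFSet.pair w z ∈ p

/-- `Att (v j) (v k) (v i)`, with bound variables `10`–`13`. -/
def fAtt (i j k : ℕ) : Fml :=
  .all 10 (.all 11 (.impl (fPM 10 11 i) (fAnd (.mem 10 j) (fAnd
    (.all 12 (.impl (.mem 12 j) (.impl (fPM 12 10 k) (fEx 13 (fPM 12 13 i)))))
    (.all 13 (fIff (.mem 13 11) (fEx 12 (fAnd (.mem 12 j) (fAnd (fPM 12 10 k) (fPM 12 13 i))))))))))

variable {M : ZFSet} (hM : IsTransModel M)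

include hM

theorem SatE_att {i j k : ℕ} (hi : i < 10) (hj : j < 10) (hk : k < 10) (v : ℕ → El M) :
    SatE (fAtt i j k) v ↔ Att (v j).1 (v k).1 (v i).1 := by
  have e : ∀ {a b : ℕ}, a < 10 → 10 ≤ b → a ≠ b := by intro a b h1 h2; omega
  have i0 := e hi (b := 10) (by omega)
  have i1 := e hi (b := 11) (by omega)
  have i2 := e hi (b := 12) (by omega)
  have i3 := e hi (b := 13) (by omega)
  have j0 := e hj (b := 10) (by omega)
  have j1 := e hj (b := 11) (by omega)
  have j2 := e hj (b := 12) (by omega)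
  have j3 := e hj (b := 13) (by omega)
  have k0 := e hk (b := 10) (by omega)
  have k1 := e hk (b := 11) (by omega)
  have k2 := e hk (b := 12) (by omega)
  have k3 := e hk (b := 13) (by omega)
  simp [fAtt, Att, SatE_all, SatE_impl, SatE_and, SatE_mem, SatE_pm hM, SatE_ex, SatE_iff,
    Function.update_of_ne, i0, i1, i2, i3, j0, j1, j2, j3, k0, k1, k2, k3, -Subtype.forall,
    -Subtype.exists]
  have ofp := fun {a b : ZFSet} (h : ZFSet.pair a b ∈ (v i).1) => of_pair_mem hM (v i).2 h
  constructor
  · intro H u y huy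
    have hm := ofp huy
    obtain ⟨h1, h2, h3⟩ := H ⟨u, hm.1⟩ ⟨y, hm.2⟩ huy
    refine ⟨h1, fun w hw hwu => ?_, fun z => ⟨fun hz => ?_, ?_⟩⟩
    · obtain ⟨z, hz⟩ := h2 ⟨w, tr_mem hM (v j).2 hw⟩ hw hwu
      exact ⟨z, hz⟩
    · obtain ⟨w, hw⟩ := (h3 ⟨z, tr_mem hM hm.2 hz⟩).1 hz
      exact ⟨w, hw⟩
    · rintro ⟨w, hw, hwu, hwz⟩
      exact (h3 ⟨z, (ofp hwz).2⟩).2 ⟨⟨w, (ofp hwz).1⟩, hw, hwu, hwz⟩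
  · intro H u y huy
    obtain ⟨h1, h2, h3⟩ := H u y huy
    refine ⟨h1, fun w hw hwu => ?_, fun z => ⟨fun hz => ?_, ?_⟩⟩
    · obtain ⟨z, hz⟩ := h2 w hw hwu
      exact ⟨⟨z, (ofp hz).2⟩, hz⟩
    · obtain ⟨w, hw, hwu, hwz⟩ := (h3 z).1 hz
      exact ⟨⟨w, (ofp hwz).1⟩, hw, hwu, hwz⟩
    · rintro ⟨w, hw, hwu, hwz⟩
      exact (h3 z).2 ⟨w, hw, hwu, hwz⟩

omit hM

theorem wo_induction {x r : ZFSet} (hr : IsWellOrderOn x r) (P : ZFSet → Prop)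
    (step : ∀ u ∈ x, (∀ w ∈ x, ZFSet.pair w u ∈ r → P w) → P u) : ∀ u ∈ x, P u := by
  by_contra hcon
  push Not at hcon
  obtain ⟨u, hu, hPu⟩ := hcon
  obtain ⟨a, ⟨ha, hPa⟩, hmin⟩ := hr.2.2.2.2 {u | u ∈ x ∧ ¬ P u} (fun u hu => hu.1) ⟨u, hu, hPu⟩
  refine hPa (step a ha fun w hw hwa => ?_)
  by_contra hPw
  exact hmin w ⟨hw, hPw⟩ hwa

theorem att_unique {x r : ZFSet} (hr : IsWellOrderOn x r) : ∀ u ∈ x, ∀ p p', Att x r p →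
    Att x r p' → ∀ y y', ZFSet.pair u y ∈ p → ZFSet.pair u y' ∈ p' → y = y' := by
  refine wo_induction hr _ ?_
  intro u hu ih p p' hp hp' y y' h h'
  obtain ⟨-, h2, h3⟩ := hp u y h
  obtain ⟨-, h2', h3'⟩ := hp' u y' h'
  ext z
  rw [h3, h3']
  constructor
  · rintro ⟨w, hw, hwu, hwz⟩
    obtain ⟨z', hz'⟩ := h2' w hw hwu
    obtain rfl := ih w hw hwu p p' hp hp' z z' hwz hz'
    exact ⟨w, hw, hwu, hz'⟩
  · rintro ⟨w, hw, hwu, hwz⟩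
    obtain ⟨z', hz'⟩ := h2 w hw hwu
    obtain rfl := ih w hw hwu p p' hp hp' z' z hz' hwz
    exact ⟨w, hw, hwu, hz'⟩

include hM

/-- Attempts can be glued. -/
theorem att_union {x r S : ZFSet} (hx : x ∈ M) (hrM : r ∈ M) (hr : IsWellOrderOn x r)
    (hS : S ∈ M) (h : ∀ u ∈ S, ∃ p ∈ M, Att x r p ∧ ∃ y ∈ M, ZFSet.pair u y ∈ p) :
    ∃ p ∈ M, Att x r p ∧ ∀ u ∈ S, ∃ y ∈ M, ZFSet.pair u y ∈ p := by
  obtain ⟨B, hB, hB'⟩ := coll_mem hM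
    (Q := fun u p => Att x r p ∧ ∃ y ∈ M, ZFSet.pair u y ∈ p) hS
    (fAnd (fAtt 1 2 3) (fEx 4 (fPM 0 4 1)))
    (Function.update (fun _ => ⟨x, hx⟩) 3 ⟨r, hrM⟩)
    (by intro u p
        simp [SatE_and, SatE_ex, SatE_pm hM, SatE_att hM]) h
  have hC : ZFSet.sep (fun p => Att x r p) B ∈ M := by
    refine sep_mem hM hB (fAtt 0 2 3) (Function.update (fun _ => ⟨x, hx⟩) 3 ⟨r, hrM⟩) ?_
    intro p
    simp [SatE_att hM]
  refine ⟨_, sUnion_mem hM hC, ?_, ?_⟩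
  · intro u y huy
    obtain ⟨p, hp, hup⟩ := ZFSet.mem_sUnion.1 huy
    obtain ⟨hpB, hpa⟩ := ZFSet.mem_sep.1 hp
    obtain ⟨h1, h2, h3⟩ := hpa u y hup
    refine ⟨h1, fun w hw hwu => ?_, fun z => ⟨fun hz => ?_, ?_⟩⟩
    · obtain ⟨z, hz⟩ := h2 w hw hwu
      exact ⟨z, ZFSet.mem_sUnion.2 ⟨p, hp, hz⟩⟩
    · obtain ⟨w, hw, hwu, hwz⟩ := (h3 z).1 hz
      exact ⟨w, hw, hwu, ZFSet.mem_sUnion.2 ⟨p, hp, hwz⟩⟩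
    · rintro ⟨w, hw, hwu, hwz⟩
      obtain ⟨p', hp', hwz'⟩ := ZFSet.mem_sUnion.1 hwz
      obtain ⟨z', hz'⟩ := h2 w hw hwu
      obtain rfl := att_unique hr w hw p' p (ZFSet.mem_sep.1 hp').2 hpa z z' hwz' hz'
      exact (h3 z).2 ⟨w, hw, hwu, hz'⟩
  · intro u hu
    obtain ⟨p, hp, hpa, y, hy, huy⟩ := hB' u hu
    exact ⟨y, hy, ZFSet.mem_sUnion.2 ⟨p, ZFSet.mem_sep.2 ⟨hp, hpa⟩, huy⟩⟩

theorem att_exists {x r : ZFSet} (hx : x ∈ M) (hrM : r ∈ M) (hr : IsWellOrderOn x r) :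
    ∃ p ∈ M, Att x r p ∧ ∀ u ∈ x, ∃ y ∈ M, ZFSet.pair u y ∈ p := by
  refine att_union hM hx hrM hr hx ?_
  refine wo_induction hr _ ?_
  intro u hu ih
  have huM := tr_mem hM hx hu
  have hS : ZFSet.sep (fun w => ZFSet.pair w u ∈ r) x ∈ M := by
    refine sep_mem hM hx (fPM 0 2 3) (Function.update (fun _ => ⟨u, huM⟩) 3 ⟨r, hrM⟩) ?_
    intro p
    simp [SatE_pm hM]
  obtain ⟨p, hp, hpa, hpd⟩ := att_union hM hx hrM hr hS
    (fun w hw => ih w (ZFSet.mem_sep.1 hw).1 (ZFSet.mem_sep.1 hw).2)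
  have hpd : ∀ w ∈ x, ZFSet.pair w u ∈ r → ∃ y, ZFSet.pair w y ∈ p := by
    intro w hw hwu
    obtain ⟨y, _, h⟩ := hpd w (ZFSet.mem_sep.2 ⟨hw, hwu⟩)
    exact ⟨y, h⟩
  by_cases hcase : ∃ y ∈ M, ZFSet.pair u y ∈ p
  · exact ⟨p, hp, hpa, hcase⟩
  have hY : ZFSet.sep (fun z => ∃ w ∈ M, w ∈ x ∧ ZFSet.pair w u ∈ r ∧ ZFSet.pair w z ∈ p)
      (⋃₀ (⋃₀ p)) ∈ M := by
    refine sep_mem hM (sUnion_mem hM (sUnion_mem hM hp))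
      (fEx 1 (fAnd (.mem 1 2) (fAnd (fPM 1 3 4) (fPM 1 0 5))))
      (Function.update (Function.update (Function.update (fun _ => ⟨x, hx⟩) 3 ⟨u, huM⟩)
        4 ⟨r, hrM⟩) 5 ⟨p, hp⟩) ?_
    intro z
    simp [SatE_ex, SatE_and, SatE_mem, SatE_pm hM]
    exact exists_congr fun _ => by tauto
  set Y := ZFSet.sep (fun z => ∃ w ∈ M, w ∈ x ∧ ZFSet.pair w u ∈ r ∧ ZFSet.pair w z ∈ p)
      (⋃₀ (⋃₀ p)) with hYdef
  have hYmem : ∀ z, z ∈ Y ↔ ∃ w ∈ x, ZFSet.pair w u ∈ r ∧ ZFSet.pair w z ∈ p := by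
    intro z
    rw [hYdef, ZFSet.mem_sep]
    constructor
    · rintro ⟨_, w, _, h⟩
      exact ⟨w, h⟩
    · rintro ⟨w, hw, hwu, hwz⟩
      refine ⟨ZFSet.mem_sUnion.2 ⟨{w, z}, ZFSet.mem_sUnion.2 ⟨_, hwz, ?_⟩, ?_⟩,
        w, tr_mem hM hx hw, hw, hwu, hwz⟩
      · simp [ZFSet.pair]
      · simp
  have hmem : ∀ a b, ZFSet.pair a b ∈ p ∪ {ZFSet.pair u Y} ↔
      (ZFSet.pair a b ∈ p ∨ a = u ∧ b = Y) := by
    intro a b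
    rw [ZFSet.mem_union, ZFSet.mem_singleton, ZFSet.pair_inj]
  have hup : ∀ y, ZFSet.pair u y ∉ p := fun y hy => hcase ⟨y, (of_pair_mem hM hp hy).2, hy⟩
  refine ⟨p ∪ {ZFSet.pair u Y}, union_mem hM hp (sing_mem hM (pair_mem hM huM hY)), ?_,
    Y, hY, (hmem _ _).2 (Or.inr ⟨rfl, rfl⟩)⟩
  intro a b hab
  rcases (hmem a b).1 hab with h | ⟨rfl, rfl⟩
  · obtain ⟨h1, h2, h3⟩ := hpa a b h
    refine ⟨h1, fun w hw hwu => ?_, fun z => ⟨fun hz => ?_, ?_⟩⟩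
    · obtain ⟨z, hz⟩ := h2 w hw hwu
      exact ⟨z, (hmem _ _).2 (Or.inl hz)⟩
    · obtain ⟨w, hw, hwu, hwz⟩ := (h3 z).1 hz
      exact ⟨w, hw, hwu, (hmem _ _).2 (Or.inl hwz)⟩
    · rintro ⟨w, hw, hwu, hwz⟩
      rcases (hmem _ _).1 hwz with h | ⟨rfl, rfl⟩
      · exact (h3 z).2 ⟨w, hw, hwu, h⟩
      · obtain ⟨z, hz⟩ := h2 w hw hwu
        exact (hup z hz).elim
  · refine ⟨hu, fun w hw hwu => ?_, fun z => ?_⟩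
    · obtain ⟨z, hz⟩ := hpd w hw hwu
      exact ⟨z, (hmem _ _).2 (Or.inl hz)⟩
    · rw [hYmem]
      constructor
      · rintro ⟨w, hw, hwu, hwz⟩
        exact ⟨w, hw, hwu, (hmem _ _).2 (Or.inl hwz)⟩
      · rintro ⟨w, hw, hwu, hwz⟩
        rcases (hmem _ _).1 hwz with h | ⟨rfl, rfl⟩
        · exact ⟨w, hw, hwu, h⟩
        · exact (hr.2.2.2.1 _ hw hwu).elim

/-- Small sets have size less than `lam` in the model. -/
theorem size_of_small {x lam : ZFSet} (hl : Reg M lam) (hx : x ∈ M) (hs : Small' M lam x) :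
    SizeLTin M.toSet x lam := by
  obtain ⟨r, hrM, hr⟩ := hM.2.2.2.2.2.2 x hx
  obtain ⟨p, hp, hpa, hpd⟩ := att_exists hM hx hrM hr
  have huniq : ∀ u y y', ZFSet.pair u y ∈ p → ZFSet.pair u y' ∈ p → y = y' := by
    intro u y y' h h'
    exact att_unique hr u (hpa u y h).1 p p hpa hpa y y' h h'
  obtain ⟨β, hβ, hb⟩ := hs p hp (fun a _ ξ _ ξ' _ h h' => huniq a ξ ξ' h h')
  have hβo := hl.ord.mem hβ
  have htr : ∀ u y, ZFSet.pair u y ∈ p → y.IsTransitive := by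
    intro u y huy z hz w' hw'
    obtain ⟨hu, _, h3⟩ := hpa u y huy
    obtain ⟨w, hw, hwu, hwz⟩ := (h3 z).1 hz
    obtain ⟨w2, hw2, hw2w, hw2z⟩ := ((hpa w z hwz).2.2 w').1 hw'
    exact (h3 w').2 ⟨w2, hw2, hr.2.2.1 w2 hw2 w hw u hu hw2w hwu, hw2z⟩
  have hord : ∀ u y, ZFSet.pair u y ∈ p → y.IsOrdinal := by
    intro u y huy
    refine ZFSet.isOrdinal_iff_forall_mem_isTransitive.2 ⟨htr u y huy, fun z hz => ?_⟩
    obtain ⟨w, hw, hwu, hwz⟩ := ((hpa u y huy).2.2 z).1 hz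
    exact htr w z hwz
  have hval : ∀ u ∈ x, ∀ y, ZFSet.pair u y ∈ p → y ∈ β := by
    refine wo_induction hr _ ?_
    intro u hu ih y huy
    have hsub : y ⊆ β := by
      intro z hz
      obtain ⟨w, hw, hwu, hwz⟩ := ((hpa u y huy).2.2 z).1 hz
      exact ih w hw hwu z hwz
    exact hb u hu y ((hord u y huy).mem_of_subset_of_mem hl.ord hsub hβ) huy
  obtain ⟨g, hg, hg', hgp⟩ := rel_mem hM (R := fun u y => ZFSet.pair u y ∈ p) hx
    (tr_mem hM hl.mem hβ) (fPM 1 2 3) (fun _ => ⟨p, hp⟩)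
    (by intro q u y
        simp [SatE_pm hM])
  have hfun : IsZFunc x g := by
    refine ⟨fun q hq => ?_, fun a ha => ?_⟩
    · obtain ⟨u, hu, y, _, h⟩ := hgp q hq
      exact ⟨u, hu, y, h⟩
    · obtain ⟨y, _, hy⟩ := hpd a ha
      exact ⟨y, (hg' _ _).2 ⟨ha, hval a ha y hy, hy⟩,
        fun y' hy' => huniq a y' y ((hg' _ _).1 hy').2.2 hy⟩
  refine ⟨β, hβ, g, hg, hfun, fun a ha => ((hg' _ _).1 (fapp_mem hfun ha)).2.1, ?_⟩
  intro a ha b hb' hab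
  have h1 := ((hg' _ _).1 (fapp_mem hfun ha)).2.2
  have h2 := ((hg' _ _).1 (fapp_mem hfun hb')).2.2
  rw [hab] at h1
  rcases hr.2.1 a ha b hb' with h | h | h
  · exact h
  · exact (ZFSet.mem_irrefl _ (((hpa _ _ h2).2.2 _).2 ⟨a, ha, h, h1⟩)).elim
  · exact (ZFSet.mem_irrefl _ (((hpa _ _ h1).2.2 _).2 ⟨b, hb', h, h2⟩)).elim

end Collapse

/-! ### The structure `H_lam` of a model -/

section HStructure

/-- `v i ⊆ v j` -/
def fSub (i j : ℕ) : Fml := .all 10 (.impl (.mem 10 i) (.mem 10 j))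

/-- `v i` is transitive -/
def fTrans (i : ℕ) : Fml :=
  .all 10 (.impl (.mem 10 i) (.all 11 (.impl (.mem 11 10) (.mem 11 i))))

/-- `v i` is small with respect to `v j` -/
def fSmall (i j : ℕ) : Fml :=
  .all 10 (.impl
    (.all 11 (.impl (.mem 11 i) (.all 12 (.impl (.mem 12 j) (.all 13 (.impl (.mem 13 j)
      (.impl (fPM 11 12 10) (.impl (fPM 11 13 10) (.eq 12 13)))))))))
    (fEx 13 (fAnd (.mem 13 j) (.all 11 (.impl (.mem 11 i) (.all 12 (.impl (.mem 12 j)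
      (.impl (fPM 11 12 10) (.mem 12 13)))))))))

variable {M : ZFSet} (hM : IsTransModel M)

include hM

theorem forall_mem_El {a : ZFSet} (ha : a ∈ M) (P : ZFSet → Prop) :
    (∀ x : El M, x.1 ∈ a → P x.1) ↔ ∀ x ∈ a, P x :=
  ⟨fun h x hx => h ⟨x, tr_mem hM ha hx⟩ hx, fun h x hx => h x.1 hx⟩

theorem SatE_sub {i j : ℕ} (hi : i < 10) (hj : j < 10) (v : ℕ → El M) :
    SatE (fSub i j) v ↔ (v i).1 ⊆ (v j).1 := by
  have i0 : i ≠ 10 := by omega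
  have j0 : j ≠ 10 := by omega
  simp [fSub, SatE_all, SatE_impl, SatE_mem, Function.update_of_ne, i0, j0,
    -Subtype.forall, -Subtype.exists]
  exact forall_mem_El hM (v i).2 (fun x => x ∈ (v j).1)

theorem SatE_trans {i : ℕ} (hi : i < 10) (v : ℕ → El M) :
    SatE (fTrans i) v ↔ (v i).1.IsTransitive := by
  have i0 : i ≠ 10 := by omega
  have i1 : i ≠ 11 := by omega
  simp [fTrans, SatE_all, SatE_impl, SatE_mem, Function.update_of_ne, i0, i1,
    -Subtype.forall, -Subtype.exists]
  constructor
  · intro h x hx y hy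
    have hxM := tr_mem hM (v i).2 hx
    exact h ⟨x, hxM⟩ hx ⟨y, tr_mem hM hxM hy⟩ hy
  · intro h x hx y hy
    exact h x.1 hx hy

theorem SatE_small {i j : ℕ} (hi : i < 10) (hj : j < 10) (v : ℕ → El M) :
    SatE (fSmall i j) v ↔ Small' M (v j).1 (v i).1 := by
  have e : ∀ {a b : ℕ}, a < 10 → 10 ≤ b → a ≠ b := by intro a b h1 h2; omega
  have i0 := e hi (b := 10) (by omega)
  have i1 := e hi (b := 11) (by omega)
  have i2 := e hi (b := 12) (by omega)
  have i3 := e hi (b := 13) (by omega)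
  have j0 := e hj (b := 10) (by omega)
  have j1 := e hj (b := 11) (by omega)
  have j2 := e hj (b := 12) (by omega)
  have j3 := e hj (b := 13) (by omega)
  simp [fSmall, SatE_all, SatE_impl, SatE_and, SatE_mem, SatE_eq, SatE_pm hM, SatE_ex,
    Function.update_of_ne, i0, i1, i2, i3, j0, j1, j2, j3, -Subtype.forall,
    -Subtype.exists]
  have ti := fun {a : ZFSet} (h : a ∈ (v i).1) => tr_mem hM (v i).2 h
  have tj := fun {a : ZFSet} (h : a ∈ (v j).1) => tr_mem hM (v j).2 h
  constructor
  · intro H h hh hf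
    obtain ⟨β, hβ, hb⟩ := H ⟨h, hh⟩ (fun a ha ξ hξ ξ' hξ' h1 h2 =>
      Subtype.ext (hf a.1 ha ξ.1 hξ ξ'.1 hξ' h1 h2))
    exact ⟨β.1, hβ, fun a ha ξ hξ h1 => hb ⟨a, ti ha⟩ ha ⟨ξ, tj hξ⟩ hξ h1⟩
  · intro H h hf
    obtain ⟨β, hβ, hb⟩ := H h.1 h.2 (fun a ha ξ hξ ξ' hξ' h1 h2 =>
      congrArg Subtype.val
        (hf ⟨a, ti ha⟩ ha ⟨ξ, tj hξ⟩ hξ ⟨ξ', tj hξ'⟩ hξ' h1 h2))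
    exact ⟨⟨β, tj hβ⟩, hβ, fun a ha ξ hξ h1 => hb a.1 ha ξ.1 hξ h1⟩

variable {lam : ZFSet} (hl : Reg M lam)

include hl

theorem mem_HIn {x : ZFSet} : x ∈ HIn M lam ↔
    x ∈ M ∧ ∃ t ∈ M, x ⊆ t ∧ t.IsTransitive ∧ Small' M lam t := by
  constructor
  · rintro ⟨hx, t, ht, h1, h2, h3⟩
    exact ⟨hx, t, ht, h1, h2, small_of_size hM hl ht h3⟩
  · rintro ⟨hx, t, ht, h1, h2, h3⟩
    exact ⟨hx, t, ht, h1, h2, size_of_small hM hl ht h3⟩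

theorem sep_HIn {y : ZFSet} (hy : y ∈ M) : ZFSet.sep (fun x => x ∈ HIn M lam) y ∈ M := by
  refine sep_mem hM hy (fEx 1 (fAnd (fSub 0 1) (fAnd (fTrans 1) (fSmall 1 2))))
    (fun _ => ⟨lam, hl.mem⟩) ?_
  intro x
  rw [mem_HIn hM hl]
  simp [SatE_ex, SatE_and, SatE_sub hM, SatE_trans hM, SatE_small hM]
  try exact exists_congr fun _ => by tauto

theorem small_of_HIn {x : ZFSet} (h : x ∈ HIn M lam) : Small' M lam x := by
  obtain ⟨hx, t, ht, h1, h2, h3⟩ := (mem_HIn hM hl).1 h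
  exact small_subset hM hl hx ht h3 h1

/-- Small subsets of `H_lam` are elements of `H_lam`. -/
theorem HIn_of_small {y : ZFSet} (hy : y ∈ M) (hs : Small' M lam y)
    (hH : ∀ a ∈ y, a ∈ HIn M lam) : y ∈ HIn M lam := by
  obtain ⟨B, hB, hB'⟩ := coll_mem hM (Q := fun a t => a ⊆ t ∧ t.IsTransitive ∧ Small' M lam t) hy
    (fAnd (fSub 0 1) (fAnd (fTrans 1) (fSmall 1 2))) (fun _ => ⟨lam, hl.mem⟩)
    (by intro a t
        simp [SatE_and, SatE_sub hM, SatE_trans hM, SatE_small hM])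
    (by intro a ha
        obtain ⟨_, t, ht, h⟩ := (mem_HIn hM hl).1 (hH a ha)
        exact ⟨t, ht, h⟩)
  have hTM : ZFSet.sep (fun z => z ∈ y ∨ ∃ a ∈ M, a ∈ y ∧
      ∀ t ∈ M, t.IsTransitive → a ⊆ t → z ∈ t) ((⋃₀ B) ∪ y) ∈ M := by
    refine sep_mem hM (union_mem hM (sUnion_mem hM hB) hy)
      (fOr (.mem 0 2) (fEx 1 (fAnd (.mem 1 2)
        (.all 3 (.impl (fTrans 3) (.impl (fSub 1 3) (.mem 0 3))))))) (fun _ => ⟨y, hy⟩) ?_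
    intro z
    simp [SatE_or, SatE_all, SatE_impl, SatE_ex, SatE_and, SatE_mem, SatE_sub hM, SatE_trans hM]
    exact or_congr_right (exists_congr fun _ => by tauto)
  set T := ZFSet.sep (fun z => z ∈ y ∨ ∃ a ∈ M, a ∈ y ∧
      ∀ t ∈ M, t.IsTransitive → a ⊆ t → z ∈ t) ((⋃₀ B) ∪ y) with hT
  have hmem : ∀ z, z ∈ T ↔ z ∈ y ∨ ∃ a ∈ y, ∀ t ∈ M, t.IsTransitive → a ⊆ t → z ∈ t := by
    intro z
    rw [hT, ZFSet.mem_sep, ZFSet.mem_union]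
    constructor
    · rintro ⟨_, h | ⟨a, _, h⟩⟩
      · exact Or.inl h
      · exact Or.inr ⟨a, h⟩
    · rintro (h | ⟨a, ha, h⟩)
      · exact ⟨Or.inr h, Or.inl h⟩
      · obtain ⟨t, ht, h1, h2, _⟩ := hB' a ha
        exact ⟨Or.inl (ZFSet.mem_sUnion.2 ⟨t, ht, h t (tr_mem hM hB ht) h2 h1⟩),
          Or.inr ⟨a, tr_mem hM hy ha, ha, h⟩⟩
  refine (mem_HIn hM hl).2 ⟨hy, T, hTM, fun z hz => (hmem z).2 (Or.inl hz), ?_, ?_⟩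
  · intro z hz w hw
    rcases (hmem z).1 hz with h | ⟨a, ha, h⟩
    · exact (hmem w).2 (Or.inr ⟨z, h, fun t _ _ hzt => hzt hw⟩)
    · exact (hmem w).2 (Or.inr ⟨a, ha, fun t htM ht hat => ht z (h t htM ht hat) hw⟩)
  · intro h hh hf
    -- the bound for a single `a ∈ y`
    let Bd : ZFSet → ZFSet → Prop := fun a β => ∀ z ∈ M,
      (∀ t ∈ M, t.IsTransitive → a ⊆ t → z ∈ t) → ∀ ξ ∈ M, ξ ∈ lam → ZFSet.pair z ξ ∈ h → ξ ∈ β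
    have hBd : ∀ a ∈ y, ∃ β ∈ lam, Bd a β := by
      intro a ha
      obtain ⟨t, ht, h1, h2, h3⟩ := hB' a ha
      have htM := tr_mem hM hB ht
      have haM := tr_mem hM hy ha
      have hTa : ZFSet.sep (fun z => ∀ t ∈ M, t.IsTransitive → a ⊆ t → z ∈ t) t ∈ M := by
        refine sep_mem hM htM (.all 3 (.impl (fTrans 3) (.impl (fSub 1 3) (.mem 0 3))))
          (fun _ => ⟨a, haM⟩) ?_
        intro z
        simp [SatE_all, SatE_impl, SatE_mem, SatE_sub hM, SatE_trans hM]
      have hsm := small_subset hM hl hTa htM h3 (fun z hz => (ZFSet.mem_sep.1 hz).1)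
      obtain ⟨β, hβ, hb⟩ := hsm h hh (by
        intro z hz
        exact hf z ((hmem z).2 (Or.inr ⟨a, ha, (ZFSet.mem_sep.1 hz).2⟩)))
      refine ⟨β, hβ, fun z hzM hz ξ _ hξ h4 => hb z ?_ ξ hξ h4⟩
      exact ZFSet.mem_sep.2 ⟨hz t htM h2 h1, hz⟩
    have hmin : ∀ a ∈ y, ∃ β ∈ lam, Bd a β ∧ ∀ β' ∈ M, β' ∈ β → ¬ Bd a β' := by
      intro a ha
      obtain ⟨β, ⟨hβ, hb⟩, hm⟩ := ZFSet.mem_wf.has_min {β | β ∈ lam ∧ Bd a β} (hBd a ha)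
      exact ⟨β, hβ, hb, fun β' _ hβ' hb' => hm β' ⟨hl.ord.mem_trans hβ' hβ, hb'⟩ hβ'⟩
    obtain ⟨β, hβ, hb⟩ := small_def hM hl
      (R := fun a β => Bd a β ∧ ∀ β' ∈ M, β' ∈ β → ¬ Bd a β') hy hs
      (fAnd
        (.all 5 (.impl (.all 6 (.impl (fTrans 6) (.impl (fSub 1 6) (.mem 5 6))))
          (.all 7 (.impl (.mem 7 3) (.impl (fPM 5 7 4) (.mem 7 2))))))
        (.all 8 (.impl (.mem 8 2) (.neg
        (.all 5 (.impl (.all 6 (.impl (fTrans 6) (.impl (fSub 1 6) (.mem 5 6))))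
          (.all 7 (.impl (.mem 7 3) (.impl (fPM 5 7 4) (.mem 7 8))))))))))
      (Function.update (fun _ => ⟨lam, hl.mem⟩) 4 ⟨h, hh⟩)
      (by intro q a β
          simp [SatE_and, SatE_all, SatE_impl, SatE_neg, SatE_mem, SatE_sub hM, SatE_trans hM,
            SatE_pm hM, Bd]
          exact Iff.rfl)
      (by rintro a _ ξ hξ ξ' hξ' ⟨h1, h2⟩ ⟨h3, h4⟩
          rcases (hl.ord.mem hξ).mem_trichotomous (hl.ord.mem hξ') with h | h | h
          · exact (h4 ξ (tr_mem hM hl.mem hξ) h h1).elim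
          · exact h
          · exact (h2 ξ' (tr_mem hM hl.mem hξ') h h3).elim)
    obtain ⟨β0, hβ0, hb0⟩ := hs h hh (fun a ha => hf a ((hmem a).2 (Or.inl ha)))
    obtain ⟨β2, hβ2, hs1, hs2⟩ := max_mem hM hl hβ0 hβ
    refine ⟨β2, hβ2, fun z hz ξ hξ hzξ => ?_⟩
    rcases (hmem z).1 hz with h1 | ⟨a, ha, h1⟩
    · exact hs1 (hb0 z h1 ξ hξ hzξ)
    · obtain ⟨γ, hγ, hg, hg'⟩ := hmin a ha
      have h2 := hb a ha γ hγ ⟨hg, hg'⟩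
      have h3 := hg z (tr_mem hM hTM hz) h1 ξ (tr_mem hM hl.mem hξ) hξ hzξ
      exact hs2 ((hl.ord.mem hβ).mem_trans h3 h2)

theorem HIn_pair {a b : ZFSet} (ha : a ∈ HIn M lam) (hb : b ∈ HIn M lam) :
    ZFSet.pair a b ∈ HIn M lam := by
  have key : ∀ {a b : ZFSet}, a ∈ HIn M lam → b ∈ HIn M lam → ({a, b} : ZFSet) ∈ HIn M lam := by
    intro a b ha hb
    refine HIn_of_small hM hl (upair_mem hM ha.1 hb.1) (small_upair hM hl ha.1 hb.1) ?_
    intro z hz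
    rcases ZFSet.mem_pair.1 hz with rfl | rfl
    · exact ha
    · exact hb
  have h := key (key ha ha) (key ha hb)
  rwa [ZFSet.pair_eq_singleton] at h

theorem HIn_of_mem_lam {γ : ZFSet} (hγ : γ ∈ lam) : γ ∈ HIn M lam :=
  (mem_HIn hM hl).2 ⟨tr_mem hM hl.mem hγ, γ, tr_mem hM hl.mem hγ, fun _ h => h,
    (hl.ord.mem hγ).isTransitive, small_of_mem hM hl hγ⟩

/-- Size below `δ` in the model passes to `H_lam`. -/
theorem size_HIn {x δ : ZFSet} (hδ : δ ⊆ lam) (hx : x ∈ M) (hxH : ∀ a ∈ x, a ∈ HIn M lam)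
    (h : SizeLTin M.toSet x δ) : x ∈ HIn M lam ∧ SizeLTin (HIn M lam) x δ := by
  obtain ⟨γ, hγ, f, hf, hfun, hmap, hinj⟩ := h
  have hγ' : γ ∈ lam := hδ hγ
  have hf : f ∈ M := hf
  have hsx : Small' M lam x := small_of_size hM hl hx ⟨γ, hγ', f, hf, hfun, hmap, hinj⟩
  refine ⟨HIn_of_small hM hl hx hsx hxH, γ, hγ, f, ?_, hfun, hmap, hinj⟩
  refine HIn_of_small hM hl hf ?_ ?_
  · intro h hh hhf
    obtain ⟨β, hβ, hb⟩ := small_def hM hl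
      (R := fun a ξ => ∃ q ∈ M, q ∈ f ∧ ZFSet.pair q ξ ∈ h ∧ ∃ b ∈ M, q = ZFSet.pair a b) hx hsx
      (fEx 5 (fAnd (.mem 5 3) (fAnd (fPM 5 2 4) (fEx 6 (fPair 5 1 6)))))
      (Function.update (fun _ => ⟨f, hf⟩) 4 ⟨h, hh⟩)
      (by intro q a ξ
          refine Iff.trans (b := ∃ q : El M, q.1 ∈ f ∧ ZFSet.pair q.1 ξ.1 ∈ h ∧
            ∃ b : El M, q.1 = ZFSet.pair a.1 b.1) (by
              simp [SatE_ex, SatE_and, SatE_mem, SatE_pm hM, SatE_pair hM, -Subtype.exists]) ?_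
          constructor
          · rintro ⟨q, h1, h2, b, h3⟩
            exact ⟨q.1, q.2, h1, h2, b.1, b.2, h3⟩
          · rintro ⟨q, hq, h1, h2, b, hb, h3⟩
            exact ⟨⟨q, hq⟩, h1, h2, ⟨b, hb⟩, h3⟩)
      (by rintro a ha ξ hξ ξ' hξ' ⟨q, _, hq, h1, b, _, rfl⟩ ⟨q', _, hq', h1', b', _, rfl⟩
          obtain rfl := (hfun.2 a ha).unique hq hq'
          exact hhf _ hq ξ hξ ξ' hξ' h1 h1')
    refine ⟨β, hβ, fun q hq ξ hξ h1 => ?_⟩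
    obtain ⟨a, ha, b, rfl⟩ := hfun.1 q hq
    exact hb a ha ξ hξ ⟨_, tr_mem hM hf hq, hq, h1, b, (of_pair_mem hM hf hq).2, rfl⟩
  · intro q hq
    obtain ⟨a, ha, b, rfl⟩ := hfun.1 q hq
    have hb := hmap a ha
    rw [fapp_eq hfun ha hq] at hb
    exact HIn_pair hM hl (hxH a ha)
      (HIn_of_mem_lam hM hl (hl.ord.mem_trans hb hγ'))

end HStructure

theorem SizeLTin.mono {D D' : Set ZFSet} (h : D ⊆ D') {x δ : ZFSet} (hx : SizeLTin D x δ) :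
    SizeLTin D' x δ := by
  obtain ⟨γ, hγ, f, hf, h'⟩ := hx
  exact ⟨γ, hγ, f, h hf, h'⟩

theorem SizeLTin.subset {M x y δ : ZFSet} (hM : IsTransModel M) (hδ : δ ∈ M) (hx : x ∈ M)
    (hxy : x ⊆ y) (h : SizeLTin M.toSet y δ) : SizeLTin M.toSet x δ := by
  obtain ⟨γ, hγ, f, hf, hfun, hmap, hinj⟩ := h
  have hf : f ∈ M := hf
  have hγ : γ ∈ δ := hγ
  obtain ⟨g, hg, hg', hgp⟩ := rel_mem hM (R := fun u y => ZFSet.pair u y ∈ f) hx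
    (tr_mem hM hδ hγ) (fPM 1 2 3) (fun _ => ⟨f, hf⟩)
    (by intro q u y
        simp [SatE_pm hM])
  have hmem : ∀ a ∈ x, ZFSet.pair a (fapp f a) ∈ g := fun a ha =>
    (hg' _ _).2 ⟨ha, hmap a (hxy ha), fapp_mem hfun (hxy ha)⟩
  have hgfun : IsZFunc x g := by
    refine ⟨fun q hq => ?_, fun a ha => ⟨_, hmem a ha, fun y hy => ?_⟩⟩
    · obtain ⟨u, hu, y, _, h⟩ := hgp q hq
      exact ⟨u, hu, y, h⟩
    · exact (fapp_eq hfun (hxy ha) ((hg' _ _).1 hy).2.2).symm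
  have heq : ∀ a ∈ x, fapp g a = fapp f a := fun a ha => fapp_eq hgfun ha (hmem a ha)
  refine ⟨γ, hγ, g, hg, hgfun, fun a ha => ?_, fun a ha b hb hab => ?_⟩
  · rw [heq a ha]; exact hmap a (hxy ha)
  · rw [heq a ha, heq b hb] at hab
    exact hinj a (hxy ha) b (hxy hb) hab

theorem Small'.down {V V' lam x : ZFSet} (hsub : V ⊆ V') (h : Small' V' lam x) :
    Small' V lam x := fun g hg => h g (hsub hg)

theorem Reg.of_regular {M lam : ZFSet} (h : IsRegularIn M.toSet lam) : Reg M lam :=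
  ⟨h.1.1.isOrdinal, h.1.2.1, h.2.1, h.2.2⟩

/-- Suppose the pair of transitive models `V ⊆ V'` satisfies the `δ`-cover
and `δ`-approximation properties and `V` and `V'` have the same ordinals. If `λ ≥ δ` is a
regular cardinal in `V'`, then the pair `H_λ^V ⊆ H_λ^{V'}` also satisfies the `δ`-cover and
`δ`-approximation properties, and `H_λ^V` and `H_λ^{V'}` have the same ordinals. -/
theorem Hlambda_cover_approx (V V' δ lam : ZFSet)
    (hV : IsTransModel V) (hV' : IsTransModel V') (hsub : V ⊆ V')
    (hδ : IsCardIn V'.toSet δ)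
    (hcov : CoverProperty δ V.toSet V'.toSet)
    (happ : ApproxProperty δ V.toSet V'.toSet)
    (hord : SameOrdinals V.toSet V'.toSet)
    (hreg : IsRegularIn V'.toSet lam) (hδlam : δ ⊆ lam) :
    CoverProperty δ (HIn V lam) (HIn V' lam) ∧
    ApproxProperty δ (HIn V lam) (HIn V' lam) ∧
    SameOrdinals (HIn V lam) (HIn V' lam) := by
  have hl' : Reg V' lam := Reg.of_regular hreg
  have hl : Reg V lam := ⟨hl'.ord, (hord lam hreg.1.1).2 hreg.1.2.1, hl'.omega,
    fun γ hγ f hf => hl'.bdd γ hγ f (hsub hf)⟩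
  have hδV : δ ∈ V := (hord δ hδ.1).2 hδ.2.1
  have hsub' : V.toSet ⊆ V'.toSet := fun x hx => hsub hx
  have hHV : HIn V lam ⊆ V.toSet := fun x hx => hx.1
  have hHV' : HIn V' lam ⊆ V'.toSet := fun x hx => hx.1
  -- the trace on `H_lam` of a set of size less than `δ`
  have htrace : ∀ Y ∈ V, SizeLTin V.toSet Y δ →
      ZFSet.sep (fun x => x ∈ HIn V lam) Y ∈ HIn V lam ∧
      SizeLTin (HIn V lam) (ZFSet.sep (fun x => x ∈ HIn V lam) Y) δ := by
    intro Y hY hYs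
    have h1 := sep_HIn hV hl hY
    exact size_HIn hV hl hδlam h1 (fun a ha => (ZFSet.mem_sep.1 ha).2)
      (SizeLTin.subset hV hδV h1 (fun z hz => (ZFSet.mem_sep.1 hz).1) hYs)
  refine ⟨?_, ?_, ?_⟩
  · intro X hX hXH hXs
    obtain ⟨Y, hY, hXY, hYs⟩ := hcov X hX.1 (hXH.trans hHV) (hXs.mono hHV')
    obtain ⟨h1, h2⟩ := htrace Y hY hYs
    exact ⟨_, h1, fun z hz => ZFSet.mem_sep.2 ⟨hXY hz, hXH hz⟩, h2⟩
  · intro X hX hXH hXa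
    have hXV : X ∈ V := by
      refine happ X hX.1 (hXH.trans hHV) ?_
      intro x hx hxs
      obtain ⟨h1, h2⟩ := htrace x hx hxs
      have h3 := hXa _ h1 h2
      have e : X ∩ ZFSet.sep (fun x => x ∈ HIn V lam) x = X ∩ x := by
        ext z
        simp only [ZFSet.mem_inter, ZFSet.mem_sep]
        exact ⟨fun h => ⟨h.1, h.2.1⟩, fun h => ⟨h.1, h.2, hXH h.1⟩⟩
      rw [e] at h3
      exact h3.1
    exact HIn_of_small hV hl hXV ((small_of_HIn hV' hl' hX).down hsub) (fun a ha => hXH ha)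
  · intro α hα
    constructor
    · rintro ⟨h1, t, ht, h2, h3, h4⟩
      exact ⟨hsub h1, t, hsub ht, h2, h3, h4.mono hsub'⟩
    · intro h
      have hαV : α ∈ V := (hord α hα).2 h.1
      exact (mem_HIn hV hl).2 ⟨hαV, α, hαV, fun _ h => h, hα.1,
        (small_of_HIn hV' hl' h).down hsub⟩

end MPaper
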